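/- arXiv:2011.00465 — 5 statements merged into one kernel-verified Lean document; each statement's English description precedes it below -/
import Mathlib

section
/- Let u, v ∈ C_c^∞(ℝ^n) and let T be a positive number with supp u ⊂ TQ and supp v ⊂ TQ, and set Φ(ξ,η) = u(ξ)v(η). Then there exists a constant c_{n,T}, depending only on n and T, such that for every L^∞ matrix A = (a_{μν})_{μ,ν∈ℤ^n} one has ‖σ_{A,Φ}‖_{M(L²×L² → (L²,ℓ¹))} ≤ c_{n,T} ‖u‖_{L^∞} ‖v‖_{L^∞} ‖A‖_B. -/
open MeasureTheory Complex
open scoped ENNReal NNReal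

noncomputable section

abbrev Rn (n : ℕ) : Type := Fin n → ℝ
abbrev Zn (n : ℕ) : Type := Fin n → ℤ

/-- Coercion of a lattice point to a point of `ℝ^n`. -/
def coeZ {n : ℕ} (μ : Zn n) : Rn n := fun i => (μ i : ℝ)

/-- The cube `aQ = [-a/2, a/2]^n`. -/
def cube (n : ℕ) (a : ℝ) : Set (Rn n) := Set.univ.pi fun _ => Set.Icc (-a / 2) (a / 2)

/-- A smooth compactly supported function. -/
def IsCcInfty {E : Type*} [NormedAddCommGroup E] [NormedSpace ℝ E] (Φ : E → ℂ) : Prop :=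
  ContDiff ℝ (⊤ : ℕ∞) Φ ∧ HasCompactSupport Φ

/-- The Fourier transform of a Schwartz function. -/
def ft {n : ℕ} (f : SchwartzMap (Rn n) ℂ) (ξ : Rn n) : ℂ :=
  ∫ x : Rn n, Complex.exp ((-2 * Real.pi * Complex.I) * ((∑ i, x i * ξ i : ℝ) : ℂ)) * f x

/-- The bilinear Fourier multiplier operator `T_σ(f,g)`. -/
def Tbil {n : ℕ} (σ : Rn n × Rn n → ℂ) (f g : SchwartzMap (Rn n) ℂ) (x : Rn n) : ℂ :=
  ∫ p : Rn n × Rn n,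
    Complex.exp ((2 * Real.pi * Complex.I) * ((∑ i, x i * (p.1 i + p.2 i) : ℝ) : ℂ)) *
      σ p * ft f p.1 * ft g p.2

/-- `L²` norm of `h(·+ν)` on the unit cube `Q`. -/
def localL2 {n : ℕ} (h : Rn n → ℂ) (ν : Zn n) : ℝ≥0∞ :=
  (∫⁻ x in cube n 1, (‖h (x + coeZ ν)‖₊ : ℝ≥0∞) ^ 2) ^ (1 / 2 : ℝ)

/-- The amalgam `(L², ℓ^q)` norm. -/
def amalgamNorm {n : ℕ} (q : ℝ≥0∞) (h : Rn n → ℂ) : ℝ≥0∞ :=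
  if q = ∞ then ⨆ ν : Zn n, localL2 h ν
  else (∑' ν : Zn n, localL2 h ν ^ q.toReal) ^ (1 / q.toReal)

/-- The multiplier norm `‖σ‖_{M(L²×L² → (L²,ℓ^q))}`. -/
def multNorm {n : ℕ} (q : ℝ≥0∞) (σ : Rn n × Rn n → ℂ) : ℝ≥0∞ :=
  ⨆ (f : SchwartzMap (Rn n) ℂ) (g : SchwartzMap (Rn n) ℂ)
    (_ : eLpNorm (⇑f) 2 volume = 1) (_ : eLpNorm (⇑g) 2 volume = 1),
    amalgamNorm q (Tbil σ f g)

/-- An `L^∞` matrix on `ℤ^n × ℤ^n`. -/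
def IsLinftyMatrix {n : ℕ} (A : Zn n → Zn n → ℂ) : Prop :=
  ∃ C : ℝ, ∀ μ ν, ‖A μ ν‖ ≤ C

/-- The norm `‖A‖_B`: the trilinear form norm over finitely supported unit `ℓ²` vectors. -/
def normB {n : ℕ} (A : Zn n → Zn n → ℂ) : ℝ≥0∞ :=
  ⨆ (F : Zn n →₀ ℂ) (G : Zn n →₀ ℂ) (H : Zn n →₀ ℂ)
    (_ : ∑ μ ∈ F.support, ‖F μ‖ ^ 2 = 1)
    (_ : ∑ ν ∈ G.support, ‖G ν‖ ^ 2 = 1)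
    (_ : ∑ ρ ∈ H.support, ‖H ρ‖ ^ 2 = 1),
    (‖∑ μ ∈ F.support, ∑ ν ∈ G.support, A μ ν * F μ * G ν * H (μ + ν)‖₊ : ℝ≥0∞)

/-- The multiplier `σ_{A,Φ}(ξ,η) = Σ_{μ,ν} a_{μν} Φ(ξ-μ, η-ν)`. -/
def sigmaA {n : ℕ} (A : Zn n → Zn n → ℂ) (Φ : Rn n × Rn n → ℂ) (p : Rn n × Rn n) : ℂ :=
  ∑' μν : Zn n × Zn n, A μν.1 μν.2 * Φ (p.1 - coeZ μν.1, p.2 - coeZ μν.2)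

/-- Condition (A) for functions on `ℝ^d`. -/
def ConditionA {d : ℕ} (Φ : Rn d → ℂ) : Prop :=
  ∃ Θ : Rn d → ℂ, ContDiff ℝ (⊤ : ℕ∞) Θ ∧ HasCompactSupport Θ ∧
    ∀ α : Zn d, (∫ x : Rn d, Θ x * Φ (x - coeZ α)) = if α = 0 then 1 else 0

/-- Condition (A) for functions on `ℝ^n × ℝ^n` (i.e. `d = 2n`). -/
def ConditionA2 {n : ℕ} (Φ : Rn n × Rn n → ℂ) : Prop :=
  ∃ Θ : Rn n × Rn n → ℂ, ContDiff ℝ (⊤ : ℕ∞) Θ ∧ HasCompactSupport Θ ∧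
    ∀ α β : Zn n, (∫ p : Rn n × Rn n, Θ p * Φ (p.1 - coeZ α, p.2 - coeZ β)) =
      if α = 0 ∧ β = 0 then 1 else 0

/-- Condition (A) for functions on `ℝ` (the case `d = 1`). -/
def ConditionA1 (Φ : ℝ → ℂ) : Prop :=
  ∃ θ : ℝ → ℂ, ContDiff ℝ (⊤ : ℕ∞) θ ∧ HasCompactSupport θ ∧
    ∀ j : ℤ, (∫ x : ℝ, θ x * Φ (x - (j : ℝ))) = if j = 0 then 1 else 0

/-- The `L^∞` (sup) norm, valued in `ℝ≥0∞`. -/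
def supNorm {E : Type*} (u : E → ℂ) : ℝ≥0∞ := ⨆ x, (‖u x‖₊ : ℝ≥0∞)

end

/-- The character `e^{2πi x·ξ}`. -/
noncomputable def charE {n : ℕ} (x ξ : Rn n) : ℂ :=
  Complex.exp ((2 * Real.pi * Complex.I) * ((∑ i, x i * ξ i : ℝ) : ℂ))

section Char
variable {n : ℕ}

lemma charE_comm (x ξ : Rn n) : charE x ξ = charE ξ x := by
  simp only [charE, mul_comm]

lemma charE_add_left (x y ξ : Rn n) : charE (x + y) ξ = charE x ξ * charE y ξ := by
  simp only [charE, ← Complex.exp_add, ← mul_add, ← Complex.ofReal_add, ← Finset.sum_add_distrib,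
    Pi.add_apply, add_mul]

lemma charE_add_right (x ξ η : Rn n) : charE x (ξ + η) = charE x ξ * charE x η := by
  rw [charE_comm, charE_add_left, charE_comm ξ, charE_comm η]

lemma norm_charE (x ξ : Rn n) : ‖charE x ξ‖ = 1 := by
  rw [charE, show (2 * Real.pi * Complex.I) * ((∑ i, x i * ξ i : ℝ) : ℂ)
    = ((2 * Real.pi * ∑ i, x i * ξ i : ℝ) : ℂ) * Complex.I by push_cast; ring]
  exact Complex.norm_exp_ofReal_mul_I _

lemma charE_coeZ (k j : Zn n) : charE (coeZ k) (coeZ j) = 1 := by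
  rw [charE, Complex.exp_eq_one_iff]
  refine ⟨∑ i, k i * j i, ?_⟩
  simp only [coeZ]
  push_cast
  ring

lemma coeZ_add (k j : Zn n) : coeZ (k + j) = coeZ k + coeZ j := by
  ext i; simp [coeZ]

lemma conj_charE (x ξ : Rn n) : (starRingEnd ℂ) (charE x ξ) = charE x (-ξ) := by
  have h2 : (starRingEnd ℂ) 2 = 2 := map_ofNat _ 2
  rw [charE, charE, ← Complex.exp_conj]
  simp [h2]

lemma coeZ_neg (k : Zn n) : coeZ (-k) = -coeZ k := by
  ext i; simp [coeZ]

lemma continuous_charE_left (ξ : Rn n) : Continuous fun x : Rn n => charE x ξ := by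
  unfold charE
  fun_prop

lemma continuous_charE_right (x : Rn n) : Continuous fun ξ : Rn n => charE x ξ := by
  unfold charE
  fun_prop

lemma isCompact_cube (a : ℝ) : IsCompact (cube n a) :=
  isCompact_univ_pi fun _ => isCompact_Icc

lemma measurableSet_cube (a : ℝ) : MeasurableSet (cube n a) :=
  (isCompact_cube a).isClosed.measurableSet

lemma integral_Icc_exp_int (k : ℤ) :
    ∫ x in Set.Icc (-1 / 2 : ℝ) (1 / 2), Complex.exp ((2 * Real.pi * Complex.I * k) * x)
      = if k = 0 then 1 else 0 := by
  rw [integral_Icc_eq_integral_Ioc, ← intervalIntegral.integral_of_le (by norm_num)]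
  split_ifs with h
  · subst h
    norm_num
  · have hc : (2 * Real.pi * Complex.I * k : ℂ) ≠ 0 := by
      have := Real.pi_ne_zero
      simp [h, this]
    rw [integral_exp_mul_complex hc, div_eq_zero_iff]
    left
    rw [sub_eq_zero, Complex.exp_eq_exp_iff_exists_int]
    refine ⟨k, ?_⟩
    push_cast
    ring

lemma integral_cube_charE (k : Zn n) :
    ∫ x in cube n 1, charE x (coeZ k) = if k = 0 then 1 else 0 := by
  have h1 : ∀ x : Rn n, charE x (coeZ k)
      = ∏ i, Complex.exp ((2 * Real.pi * Complex.I * (k i)) * (x i : ℝ)) := by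
    intro x
    rw [charE, ← Complex.exp_sum]
    congr 1
    push_cast
    rw [Finset.mul_sum]
    refine Finset.sum_congr rfl fun i _ => ?_
    simp [coeZ]
    ring
  simp_rw [h1]
  rw [cube, volume_pi, Measure.restrict_pi_pi,
    integral_fintype_prod_eq_prod (𝕜 := ℂ)
      (f := fun i (y : ℝ) => Complex.exp ((2 * Real.pi * Complex.I * (k i)) * y))]
  simp_rw [integral_Icc_exp_int]
  split_ifs with h
  · subst h; simp
  · obtain ⟨i, hi⟩ := Function.ne_iff.1 h
    exact Finset.prod_eq_zero (Finset.mem_univ i) (by simpa using hi)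

lemma lintegral_enorm_sq_eq {α : Type*} [MeasurableSpace α] {μ : Measure α} {f : α → ℂ}
    (hf : Integrable (fun x => ‖f x‖ ^ 2) μ) :
    ∫⁻ x, ‖f x‖ₑ ^ 2 ∂μ = ENNReal.ofReal (∫ x, ‖f x‖ ^ 2 ∂μ) := by
  rw [ofReal_integral_eq_lintegral_ofReal hf (Filter.Eventually.of_forall fun x => by positivity)]
  refine lintegral_congr fun x => ?_
  rw [ENNReal.ofReal_pow (norm_nonneg _), ofReal_norm]

/-- Parseval's identity for trigonometric polynomials on the unit cube. -/
lemma lintegral_trigPoly (R : Finset (Zn n)) (c : Zn n → ℂ) :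
    ∫⁻ t in cube n 1, ‖∑ ρ ∈ R, c ρ * charE t (coeZ ρ)‖ₑ ^ 2 = ∑ ρ ∈ R, ‖c ρ‖ₑ ^ 2 := by
  have hcont : Continuous fun t : Rn n => ∑ ρ ∈ R, c ρ * charE t (coeZ ρ) :=
    continuous_finsetSum _ fun ρ _ => continuous_const.mul (continuous_charE_left _)
  have hcint : ∀ {E : Type} [NormedAddCommGroup E] {F : Rn n → E}, Continuous F →
      Integrable F (volume.restrict (cube n 1)) := fun hF =>
    hF.continuousOn.integrableOn_compact (isCompact_cube 1)
  rw [lintegral_enorm_sq_eq (hcint (hcont.norm.pow 2))]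
  have h : ∫ t in cube n 1, ‖∑ ρ ∈ R, c ρ * charE t (coeZ ρ)‖ ^ 2 = ∑ ρ ∈ R, ‖c ρ‖ ^ 2 := by
    apply Complex.ofReal_injective
    rw [← integral_complex_ofReal]
    have h2 : ∀ t : Rn n, ((‖∑ ρ ∈ R, c ρ * charE t (coeZ ρ)‖ ^ 2 : ℝ) : ℂ)
        = ∑ ρ ∈ R, ∑ τ ∈ R, c ρ * (starRingEnd ℂ) (c τ) * charE t (coeZ (ρ - τ)) := by
      intro t
      rw [Complex.ofReal_pow, ← Complex.mul_conj', map_sum, Finset.sum_mul_sum]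
      refine Finset.sum_congr rfl fun ρ _ => Finset.sum_congr rfl fun τ _ => ?_
      rw [map_mul, conj_charE, sub_eq_add_neg, coeZ_add, coeZ_neg, charE_add_right]
      ring
    simp_rw [h2]
    rw [integral_finsetSum]
    · push_cast
      refine Finset.sum_congr rfl fun ρ hρ => ?_
      rw [integral_finsetSum]
      · simp_rw [integral_const_mul, integral_cube_charE, sub_eq_zero]
        simp [hρ, Complex.mul_conj']
      · exact fun τ _ => hcint (continuous_const.mul (continuous_charE_left _))
    · exact fun ρ _ => hcint (continuous_finsetSum _ fun τ _ =>
        continuous_const.mul (continuous_charE_left _))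
  rw [h, ENNReal.ofReal_sum_of_nonneg fun _ _ => by positivity]
  refine Finset.sum_congr rfl fun ρ _ => ?_
  rw [ENNReal.ofReal_pow (norm_nonneg _), ofReal_norm]

end Char

section CauchySchwarz

lemma lintegral_mul_le_sqrt {α : Type*} [MeasurableSpace α] {μ : Measure α} {f g : α → ℝ≥0∞}
    (hf : AEMeasurable f μ) (hg : AEMeasurable g μ) :
    ∫⁻ x, f x * g x ∂μ ≤ (∫⁻ x, f x ^ 2 ∂μ) ^ (1 / 2 : ℝ) * (∫⁻ x, g x ^ 2 ∂μ) ^ (1 / 2 : ℝ) := by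
  have := ENNReal.lintegral_mul_le_Lp_mul_Lq μ Real.HolderConjugate.two_two hf hg
  simpa only [ENNReal.rpow_two, Pi.mul_apply] using this

lemma sqrt_sq (x : ℝ≥0∞) : (x ^ (1 / 2 : ℝ)) ^ 2 = x := by
  rw [← ENNReal.rpow_natCast, ← ENNReal.rpow_mul]; simp

lemma sq_sqrt (x : ℝ≥0∞) : (x ^ 2) ^ (1 / 2 : ℝ) = x := by
  rw [← ENNReal.rpow_natCast, ← ENNReal.rpow_mul]; simp

lemma tsum_sqrt_mul_sqrt_le {ι : Type*} (x y : ι → ℝ≥0∞) :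
    ∑' i, x i ^ (1 / 2 : ℝ) * y i ^ (1 / 2 : ℝ)
      ≤ (∑' i, x i) ^ (1 / 2 : ℝ) * (∑' i, y i) ^ (1 / 2 : ℝ) := by
  let : MeasurableSpace ι := ⊤
  have := lintegral_mul_le_sqrt (μ := Measure.count) (f := fun i => x i ^ (1 / 2 : ℝ))
    (g := fun i => y i ^ (1 / 2 : ℝ)) (measurable_from_top.aemeasurable)
    (measurable_from_top.aemeasurable)
  simpa only [lintegral_count, sqrt_sq] using this

lemma tsum_weighted_sq_le {ι : Type*} (w b : ι → ℝ≥0∞) :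
    (∑' i, w i * b i) ^ 2 ≤ (∑' i, w i) * ∑' i, w i * b i ^ 2 := by
  have h := tsum_sqrt_mul_sqrt_le w (fun i => w i * b i ^ 2)
  have h2 : ∀ i, w i ^ (1 / 2 : ℝ) * (w i * b i ^ 2) ^ (1 / 2 : ℝ) = w i * b i := by
    intro i
    rw [ENNReal.mul_rpow_of_nonneg _ _ (by norm_num), sq_sqrt, ← mul_assoc, ← sq, sqrt_sq]
  simp_rw [h2] at h
  calc _ ≤ _ := pow_le_pow_left₀ (zero_le) h 2
    _ = _ := by rw [mul_pow, sqrt_sq, sqrt_sq]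

lemma sqrt_le_of_le_mul_sqrt {S B : ℝ≥0∞} (hS : S ≠ ∞) (h : S ≤ B * S ^ (1 / 2 : ℝ)) :
    S ^ (1 / 2 : ℝ) ≤ B := by
  rcases eq_or_ne S 0 with rfl | h0
  · simp
  have h1 : S ^ (1 / 2 : ℝ) ≠ 0 := by simp [h0]
  have h2 : S ^ (1 / 2 : ℝ) ≠ ∞ := by simp [hS]
  have h3 : S ^ (1 / 2 : ℝ) * S ^ (1 / 2 : ℝ) ≤ B * S ^ (1 / 2 : ℝ) := by
    rwa [← sq, sqrt_sq]
  exact (ENNReal.mul_le_mul_iff_left h1 h2).1 h3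

end CauchySchwarz

/-- Bessel's inequality for the characters on the unit cube. -/
lemma bessel_cube {n : ℕ} {h : Rn n → ℂ} (hi : IntegrableOn h (cube n 1)) (K : Finset (Zn n)) :
    ∑ k ∈ K, ‖∫ x in cube n 1, charE (coeZ k) x * h x‖ₑ ^ 2 ≤ ∫⁻ x in cube n 1, ‖h x‖ₑ ^ 2 := by
  set c : Zn n → ℂ := fun k => (starRingEnd ℂ) (∫ x in cube n 1, charE (coeZ k) x * h x) with hc
  set S := ∑ k ∈ K, ‖c k‖ₑ ^ 2 with hS
  have hSe : ∑ k ∈ K, ‖∫ x in cube n 1, charE (coeZ k) x * h x‖ₑ ^ 2 = S := by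
    refine Finset.sum_congr rfl fun k _ => ?_
    rw [hc, ← ofReal_norm, ← ofReal_norm, RCLike.norm_conj]
  have hmul : ∀ k, IntegrableOn (fun x => charE (coeZ k) x * h x) (cube n 1) := fun k =>
    hi.bdd_mul (c := 1) (continuous_charE_right _).aestronglyMeasurable
      (Filter.Eventually.of_forall fun x => (norm_charE _ _).le)
  have key : ((∑ k ∈ K, ‖c k‖ ^ 2 : ℝ) : ℂ)
      = ∫ x in cube n 1, h x * ∑ k ∈ K, c k * charE x (coeZ k) := by
    have : ∀ x, h x * ∑ k ∈ K, c k * charE x (coeZ k)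
        = ∑ k ∈ K, c k * (charE (coeZ k) x * h x) := by
      intro x
      rw [Finset.mul_sum]
      refine Finset.sum_congr rfl fun k _ => ?_
      rw [charE_comm]; ring
    simp_rw [this]
    rw [integral_finsetSum _ fun k _ => (hmul k).const_mul _]
    push_cast
    refine Finset.sum_congr rfl fun k _ => ?_
    rw [integral_const_mul, ← Complex.mul_conj']
    simp [hc]
  have hSfin : S ≠ ∞ := by simp [hS]
  have hle : S ≤ (∫⁻ x in cube n 1, ‖h x‖ₑ ^ 2) ^ (1 / 2 : ℝ) * S ^ (1 / 2 : ℝ) := by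
    have e1 : S = ‖((∑ k ∈ K, ‖c k‖ ^ 2 : ℝ) : ℂ)‖ₑ := by
      rw [← ofReal_norm, Complex.norm_real, Real.norm_of_nonneg (by positivity),
        ENNReal.ofReal_sum_of_nonneg fun _ _ => by positivity]
      refine Finset.sum_congr rfl fun k _ => ?_
      rw [ENNReal.ofReal_pow (norm_nonneg _), ofReal_norm]
    have hcont : Continuous fun t : Rn n => ∑ ρ ∈ K, c ρ * charE t (coeZ ρ) :=
      continuous_finsetSum _ fun ρ _ => continuous_const.mul (continuous_charE_left _)
    calc S = ‖∫ x in cube n 1, h x * ∑ k ∈ K, c k * charE x (coeZ k)‖ₑ := by rw [e1, key]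
      _ ≤ ∫⁻ x in cube n 1, ‖h x * ∑ k ∈ K, c k * charE x (coeZ k)‖ₑ :=
        enorm_integral_le_lintegral_enorm _
      _ = ∫⁻ x in cube n 1, ‖h x‖ₑ * ‖∑ k ∈ K, c k * charE x (coeZ k)‖ₑ := by
        simp_rw [enorm_mul]
      _ ≤ _ := lintegral_mul_le_sqrt hi.aestronglyMeasurable.enorm
          hcont.enorm.measurable.aemeasurable
      _ = _ := by rw [lintegral_trigPoly]
  rw [hSe]
  have := pow_le_pow_left₀ (zero_le) (sqrt_le_of_le_mul_sqrt hSfin hle) 2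
  rwa [sqrt_sq, sqrt_sq] at this

section Tiling
variable {n : ℕ}

/-- The half-open unit cube `[-1/2, 1/2)^n`. -/
def halfOpenCube (n : ℕ) : Set (Rn n) := Set.univ.pi fun _ => Set.Ico (-1 / 2) (1 / 2)

lemma measurableSet_halfOpenCube : MeasurableSet (halfOpenCube n) :=
  MeasurableSet.univ_pi fun _ => measurableSet_Ico

lemma halfOpenCube_ae_eq : halfOpenCube n =ᵐ[volume] cube n 1 := by
  have h := Measure.univ_pi_Ico_ae_eq_Icc (μ := fun _ : Fin n => (volume : Measure ℝ))
    (f := fun _ => -1 / 2) (g := fun _ => 1 / 2)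
  rw [← Set.pi_univ_Icc] at h
  exact h

/-- The lattice point closest to `x`. -/
noncomputable def roundZ (x : Rn n) : Zn n := fun i => ⌊x i + 1 / 2⌋

lemma sub_coeZ_mem_halfOpenCube {x : Rn n} {μ : Zn n} :
    x - coeZ μ ∈ halfOpenCube n ↔ μ = roundZ x := by
  simp only [halfOpenCube, Set.mem_pi, Set.mem_univ, true_imp_iff, Set.mem_Ico, Pi.sub_apply,
    coeZ, funext_iff, roundZ]
  refine forall_congr' fun i => ?_
  rw [eq_comm, Int.floor_eq_iff]
  constructor <;> rintro ⟨h1, h2⟩ <;> constructor <;> linarith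

lemma setLIntegral_halfOpenCube_add (φ : Rn n → ℝ≥0∞) (μ : Zn n) :
    ∫⁻ x in halfOpenCube n, φ (x + coeZ μ) = ∫⁻ x, if μ = roundZ x then φ x else 0 := by
  rw [← lintegral_indicator measurableSet_halfOpenCube,
    ← lintegral_sub_right_eq_self _ (coeZ μ)]
  refine lintegral_congr fun x => ?_
  classical
  rw [Set.indicator_apply]
  simp only [sub_coeZ_mem_halfOpenCube, sub_add_cancel]

lemma measurable_roundZ : Measurable (roundZ : Rn n → Zn n) := by
  unfold roundZ
  refine measurable_pi_lambda _ fun i => ?_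
  exact Int.measurable_floor.comp ((measurable_pi_apply i).add_const _)

lemma measurable_ite_roundZ {φ : Rn n → ℝ≥0∞} (hφ : Measurable φ) (μ : Zn n) :
    Measurable fun x => if μ = roundZ x then φ x else 0 :=
  Measurable.ite (measurableSet_eq_fun measurable_const measurable_roundZ) hφ measurable_const

lemma tsum_setLIntegral_halfOpenCube {φ : Rn n → ℝ≥0∞} (hφ : Measurable φ) :
    ∑' μ : Zn n, ∫⁻ x in halfOpenCube n, φ (x + coeZ μ) = ∫⁻ x, φ x := by
  simp_rw [setLIntegral_halfOpenCube_add]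
  rw [← lintegral_tsum fun μ => (measurable_ite_roundZ hφ μ).aemeasurable]
  simp

/-- The lattice points needed to cover `TQ` by translates of the unit cube. -/
noncomputable def coverZ (n : ℕ) (T : ℝ) : Finset (Zn n) :=
  Fintype.piFinset fun _ => Finset.Icc (-(⌈T⌉ + 1)) (⌈T⌉ + 1)

lemma roundZ_mem_coverZ {T : ℝ} (hT : 0 < T) {x : Rn n} (hx : x ∈ cube n T) :
    roundZ x ∈ coverZ n T := by
  simp only [cube, Set.mem_pi, Set.mem_univ, true_imp_iff, Set.mem_Icc] at hx
  simp only [coverZ, Fintype.mem_piFinset, Finset.mem_Icc, roundZ]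
  intro i
  have hc := Int.le_ceil T
  obtain ⟨h1, h2⟩ := hx i
  constructor
  · rw [Int.le_floor]; push_cast; linarith
  · rw [← Int.lt_add_one_iff, Int.floor_lt]; push_cast; linarith

lemma setLIntegral_cube_le {T : ℝ} (hT : 0 < T) {φ : Rn n → ℝ≥0∞} (hφ : Measurable φ) :
    ∫⁻ x in cube n T, φ x ≤ ∑ j ∈ coverZ n T, ∫⁻ x in halfOpenCube n, φ (x + coeZ j) := by
  simp_rw [setLIntegral_halfOpenCube_add]
  rw [← lintegral_finsetSum _ fun j _ => measurable_ite_roundZ hφ j,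
    ← lintegral_indicator (measurableSet_cube T)]
  refine lintegral_mono fun x => ?_
  classical
  rw [Set.indicator_apply]
  split_ifs with h
  · simp [roundZ_mem_coverZ hT h]
  · exact zero_le

/-- Integrals over translates of `TQ` add up to at most a multiple of the full integral. -/
lemma tsum_setLIntegral_cube_le {T : ℝ} (hT : 0 < T) {φ : Rn n → ℝ≥0∞} (hφ : Measurable φ) :
    ∑' μ : Zn n, ∫⁻ x in cube n T, φ (x + coeZ μ) ≤ (coverZ n T).card * ∫⁻ x, φ x := by
  calc _ ≤ ∑' μ : Zn n, ∑ j ∈ coverZ n T,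
        ∫⁻ x in halfOpenCube n, φ (x + coeZ j + coeZ μ) :=
        ENNReal.tsum_le_tsum fun μ => setLIntegral_cube_le hT (hφ.comp (measurable_add_const _))
    _ = ∑ j ∈ coverZ n T, ∑' μ : Zn n, ∫⁻ x in halfOpenCube n, φ (x + coeZ j + coeZ μ) :=
        Summable.tsum_finsetSum fun _ _ => ENNReal.summable
    _ = ∑ j ∈ coverZ n T, ∫⁻ x, φ x := by
        refine Finset.sum_congr rfl fun j _ => ?_
        have h := tsum_setLIntegral_halfOpenCube (φ := fun x => φ (x + coeZ j))
          (hφ.comp (measurable_add_const _))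
        rw [lintegral_add_right_eq_self] at h
        rw [← h]
        refine tsum_congr fun μ => lintegral_congr fun x => ?_
        rw [add_right_comm]
    _ = _ := by simp

lemma sq_enorm_sum_le {ι : Type*} (J : Finset ι) (z : ι → ℂ) :
    ‖∑ j ∈ J, z j‖ₑ ^ 2 ≤ J.card * ∑ j ∈ J, ‖z j‖ₑ ^ 2 := by
  have h := tsum_weighted_sq_le (fun _ : J => (1 : ℝ≥0∞)) (fun j => ‖z j‖ₑ)
  simp only [one_mul, tsum_fintype] at h
  rw [Finset.sum_coe_sort J (fun j => ‖z j‖ₑ), Finset.sum_coe_sort J (fun j => ‖z j‖ₑ ^ 2)] at h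
  calc _ ≤ _ := pow_le_pow_left₀ zero_le (enorm_sum_le J z) 2
    _ ≤ _ := h
    _ = _ := by simp

/-- Sampling inequality: the Fourier coefficients at lattice points of a function supported
in `TQ` are square summable. -/
lemma tsum_sq_enorm_integral_charE_le {T : ℝ} (hT : 0 < T) {h : Rn n → ℂ} (hm : Measurable h)
    (hi : Integrable h) (hs : Function.support h ⊆ cube n T) :
    ∑' k : Zn n, ‖∫ x, charE (coeZ k) x * h x‖ₑ ^ 2
      ≤ (coverZ n T).card * ∫⁻ x, ‖h x‖ₑ ^ 2 := by
  set J := coverZ n T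
  have hmul : ∀ k, Integrable (fun x => charE (coeZ k) x * h x) := fun k =>
    hi.bdd_mul (c := 1) (continuous_charE_right _).aestronglyMeasurable
      (Filter.Eventually.of_forall fun x => (norm_charE _ _).le)
  have hsplit : ∀ k : Zn n, ∫ x, charE (coeZ k) x * h x
      = ∑ j ∈ J, ∫ x in cube n 1, charE (coeZ k) x * h (x + coeZ j) := by
    intro k
    have e1 : ∀ j : Zn n, ∫ x in cube n 1, charE (coeZ k) x * h (x + coeZ j)
        = ∫ x, (if j = roundZ x then charE (coeZ k) x * h x else 0) := by
      intro j
      rw [← setIntegral_congr_set halfOpenCube_ae_eq, ← integral_indicator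
        measurableSet_halfOpenCube, ← integral_sub_right_eq_self _ (coeZ j)]
      refine integral_congr_ae (Filter.Eventually.of_forall fun x => ?_)
      classical
      beta_reduce
      rw [Set.indicator_apply]
      simp only [sub_coeZ_mem_halfOpenCube, sub_add_cancel]
      split_ifs with hj
      · congr 1
        conv_rhs => rw [← sub_add_cancel x (coeZ j), charE_add_right, charE_coeZ, mul_one]
      · rfl
    simp_rw [e1]
    rw [← integral_finsetSum]
    · refine integral_congr_ae (Filter.Eventually.of_forall fun x => ?_)
      by_cases hx : h x = 0
      · simp [hx]
      · have := roundZ_mem_coverZ hT (hs hx)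
        simp [J, this]
    · intro j _
      have : (fun x => if j = roundZ x then charE (coeZ k) x * h x else 0)
          = {x | j = roundZ x}.indicator fun x => charE (coeZ k) x * h x := by
        classical
        ext x; simp [Set.indicator_apply]
      rw [this]
      exact (hmul k).indicator (measurableSet_eq_fun measurable_const measurable_roundZ)
  calc _ ≤ ∑' k : Zn n, J.card * ∑ j ∈ J,
          ‖∫ x in cube n 1, charE (coeZ k) x * h (x + coeZ j)‖ₑ ^ 2 :=
        ENNReal.tsum_le_tsum fun k => by rw [hsplit]; exact sq_enorm_sum_le _ _
    _ = J.card * ∑ j ∈ J, ∑' k : Zn n,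
          ‖∫ x in cube n 1, charE (coeZ k) x * h (x + coeZ j)‖ₑ ^ 2 := by
        rw [ENNReal.tsum_mul_left, Summable.tsum_finsetSum fun _ _ => ENNReal.summable]
    _ ≤ J.card * ∑ j ∈ J, ∫⁻ x in cube n 1, ‖h (x + coeZ j)‖ₑ ^ 2 := by
        gcongr with j hj
        rw [ENNReal.tsum_eq_iSup_sum]
        exact iSup_le fun K => bessel_cube (hi.comp_add_right (coeZ j)).integrableOn K
    _ ≤ J.card * ∑' j : Zn n, ∫⁻ x in halfOpenCube n, ‖h (x + coeZ j)‖ₑ ^ 2 := by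
        gcongr
        simp_rw [setLIntegral_congr halfOpenCube_ae_eq]
        exact ENNReal.sum_le_tsum _
    _ = _ := by
        rw [tsum_setLIntegral_halfOpenCube (φ := fun x => ‖h x‖ₑ ^ 2) (hm.enorm.pow_const 2)]

end Tiling

section NormB
variable {n : ℕ}

lemma normB_finsupp_le (A : Zn n → Zn n → ℂ) (F G H : Zn n →₀ ℂ) :
    ‖∑ μ ∈ F.support, ∑ ν ∈ G.support, A μ ν * F μ * G ν * H (μ + ν)‖ₑ
      ≤ normB A * ENNReal.ofReal (√(∑ μ ∈ F.support, ‖F μ‖ ^ 2))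
        * ENNReal.ofReal (√(∑ μ ∈ G.support, ‖G μ‖ ^ 2))
        * ENNReal.ofReal (√(∑ μ ∈ H.support, ‖H μ‖ ^ 2)) := by
  rcases eq_or_ne F 0 with rfl | hF
  · simp
  rcases eq_or_ne G 0 with rfl | hG
  · simp
  rcases eq_or_ne H 0 with rfl | hH
  · simp
  have hpos : ∀ F : Zn n →₀ ℂ, F ≠ 0 → 0 < √(∑ μ ∈ F.support, ‖F μ‖ ^ 2) := by
    intro F hF
    refine Real.sqrt_pos.2 (Finset.sum_pos (fun μ hμ => ?_) (Finsupp.support_nonempty_iff.2 hF))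
    have := norm_pos_iff.2 (Finsupp.mem_support_iff.1 hμ)
    positivity
  have hsupp : ∀ (F : Zn n →₀ ℂ) (r : ℝ), 0 < r → (((r⁻¹ : ℝ) : ℂ) • F).support = F.support := by
    intro F r hr
    refine Finsupp.support_smul_eq ?_
    simp [hr.ne']
  have hnorm : ∀ F : Zn n →₀ ℂ, ∀ r : ℝ, 0 < r → r = √(∑ μ ∈ F.support, ‖F μ‖ ^ 2) →
      ∑ μ ∈ (((r⁻¹ : ℝ) : ℂ) • F).support, ‖(((r⁻¹ : ℝ) : ℂ) • F) μ‖ ^ 2 = 1 := by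
    intro F r hr hrF
    have h2 : ∑ μ ∈ F.support, ‖F μ‖ ^ 2 = r ^ 2 := by
      rw [hrF, Real.sq_sqrt (by positivity)]
    rw [hsupp F r hr]
    simp only [Finsupp.smul_apply, smul_eq_mul, norm_mul, Complex.norm_real, mul_pow,
      Real.norm_eq_abs, sq_abs]
    rw [← Finset.mul_sum, h2, inv_pow, inv_mul_cancel₀ (by positivity)]
  obtain ⟨r, hr⟩ : ∃ r, r = √(∑ μ ∈ F.support, ‖F μ‖ ^ 2) := ⟨_, rfl⟩
  obtain ⟨s, hs⟩ : ∃ r, r = √(∑ μ ∈ G.support, ‖G μ‖ ^ 2) := ⟨_, rfl⟩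
  obtain ⟨q, hq⟩ : ∃ r, r = √(∑ μ ∈ H.support, ‖H μ‖ ^ 2) := ⟨_, rfl⟩
  have hr0 : 0 < r := hr ▸ hpos F hF
  have hs0 : 0 < s := hs ▸ hpos G hG
  have hq0 : 0 < q := hq ▸ hpos H hH
  have key : ‖∑ μ ∈ (((r⁻¹ : ℝ) : ℂ) • F).support, ∑ ν ∈ (((s⁻¹ : ℝ) : ℂ) • G).support,
      A μ ν * (((r⁻¹ : ℝ) : ℂ) • F) μ * (((s⁻¹ : ℝ) : ℂ) • G) ν
        * (((q⁻¹ : ℝ) : ℂ) • H) (μ + ν)‖ₑ ≤ normB A := by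
    unfold normB
    exact le_iSup_of_le _ <| le_iSup_of_le _ <| le_iSup_of_le _ <|
      le_iSup_of_le (hnorm F r hr0 hr) <| le_iSup_of_le (hnorm G s hs0 hs) <|
      le_iSup_of_le (hnorm H q hq0 hq) le_rfl
  rw [hsupp F r hr0, hsupp G s hs0] at key
  have e : ∑ μ ∈ F.support, ∑ ν ∈ G.support, A μ ν * F μ * G ν * H (μ + ν)
      = ((r : ℝ) : ℂ) * ((s : ℝ) : ℂ) * ((q : ℝ) : ℂ) *
        ∑ μ ∈ F.support, ∑ ν ∈ G.support, A μ ν * (((r⁻¹ : ℝ) : ℂ) • F) μ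
          * (((s⁻¹ : ℝ) : ℂ) • G) ν * (((q⁻¹ : ℝ) : ℂ) • H) (μ + ν) := by
    simp_rw [Finset.mul_sum]
    refine Finset.sum_congr rfl fun μ _ => Finset.sum_congr rfl fun ν _ => ?_
    have h1 : (r : ℂ) ≠ 0 := by exact_mod_cast hr0.ne'
    have h2 : (s : ℂ) ≠ 0 := by exact_mod_cast hs0.ne'
    have h3 : (q : ℂ) ≠ 0 := by exact_mod_cast hq0.ne'
    simp only [Finsupp.smul_apply, smul_eq_mul, Complex.ofReal_inv]
    field_simp
  have hen : ∀ t : ℝ, 0 < t → ‖(t : ℂ)‖ₑ = ENNReal.ofReal t := fun t ht => by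
    rw [← ofReal_norm, Complex.norm_real, Real.norm_of_nonneg ht.le]
  rw [e, ← hr, ← hs, ← hq, enorm_mul, enorm_mul, enorm_mul, hen r hr0, hen s hs0, hen q hq0]
  calc _ ≤ _ := mul_le_mul_right key _
    _ = _ := by ring

lemma ofReal_sqrt_sum_sq {ι : Type*} (S : Finset ι) (F : ι → ℂ) :
    ENNReal.ofReal (√(∑ μ ∈ S, ‖F μ‖ ^ 2)) = (∑ μ ∈ S, ‖F μ‖ₑ ^ 2) ^ (1 / 2 : ℝ) := by
  rw [Real.sqrt_eq_rpow, ← ENNReal.ofReal_rpow_of_nonneg (by positivity) (by norm_num),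
    ENNReal.ofReal_sum_of_nonneg fun _ _ => by positivity]
  simp_rw [ENNReal.ofReal_pow (norm_nonneg _), ofReal_norm]

/-- The trilinear estimate defining `‖A‖_B`, without normalisation. -/
lemma normB_finset_le (A : Zn n → Zn n → ℂ) (S S' R : Finset (Zn n)) (F G H : Zn n → ℂ)
    (hR : ∀ μ ∈ S, ∀ ν ∈ S', μ + ν ∈ R) :
    ‖∑ μ ∈ S, ∑ ν ∈ S', A μ ν * F μ * G ν * H (μ + ν)‖ₑ
      ≤ normB A * (∑ μ ∈ S, ‖F μ‖ₑ ^ 2) ^ (1 / 2 : ℝ) * (∑ μ ∈ S', ‖G μ‖ₑ ^ 2) ^ (1 / 2 : ℝ)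
        * (∑ μ ∈ R, ‖H μ‖ₑ ^ 2) ^ (1 / 2 : ℝ) := by
  classical
  set f := Finsupp.indicator S fun μ _ => F μ with hf
  set g := Finsupp.indicator S' fun μ _ => G μ with hg
  set h := Finsupp.indicator R fun μ _ => H μ with hh
  have hval : ∀ (S : Finset (Zn n)) (F : Zn n → ℂ), ∀ μ ∈ S,
      Finsupp.indicator S (fun μ _ => F μ) μ = F μ := fun S F μ hμ => by
    simp [Finsupp.indicator_apply, hμ]
  have hsum : ∀ (S : Finset (Zn n)) (F : Zn n → ℂ),
      ∑ μ ∈ (Finsupp.indicator S fun μ _ => F μ).support,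
        ‖(Finsupp.indicator S fun μ _ => F μ) μ‖ ^ 2 = ∑ μ ∈ S, ‖F μ‖ ^ 2 := by
    intro S F
    rw [Finset.sum_subset (Finsupp.support_indicator_subset (s := S) (f := fun μ _ => F μ))]
    · exact Finset.sum_congr rfl fun μ hμ => by rw [hval S F μ hμ]
    · intro μ _ hμ
      rw [Finsupp.notMem_support_iff.1 hμ]; simp
  have key := normB_finsupp_le A f g h
  rw [hsum, hsum, hsum, ofReal_sqrt_sum_sq, ofReal_sqrt_sum_sq, ofReal_sqrt_sum_sq] at key
  have e : ∑ μ ∈ f.support, ∑ ν ∈ g.support, A μ ν * f μ * g ν * h (μ + ν)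
      = ∑ μ ∈ S, ∑ ν ∈ S', A μ ν * F μ * G ν * H (μ + ν) := by
    rw [Finset.sum_subset (Finsupp.support_indicator_subset (s := S) (f := fun μ _ => F μ))]
    · refine Finset.sum_congr rfl fun μ hμ => ?_
      rw [Finset.sum_subset (Finsupp.support_indicator_subset (s := S') (f := fun μ _ => G μ))]
      · refine Finset.sum_congr rfl fun ν hν => ?_
        rw [hf, hg, hh, hval S F μ hμ, hval S' G ν hν, hval R H _ (hR μ hμ ν hν)]
      · intro ν _ hν
        rw [Finsupp.notMem_support_iff.1 hν]; simp
    · intro μ _ hμ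
      rw [Finsupp.notMem_support_iff.1 hμ]; simp
  rwa [e] at key

/-- `L²` bound for the trigonometric polynomial built from a matrix and two sequences. -/
lemma lintegral_bilinear_trigPoly_le (A : Zn n → Zn n → ℂ) (S S' : Finset (Zn n))
    (F G : Zn n → ℂ) :
    ∫⁻ t in cube n 1, ‖∑ μ ∈ S, ∑ ν ∈ S', A μ ν * charE t (coeZ (μ + ν)) * F μ * G ν‖ₑ ^ 2
      ≤ normB A ^ 2 * (∑ μ ∈ S, ‖F μ‖ₑ ^ 2) * ∑ ν ∈ S', ‖G ν‖ₑ ^ 2 := by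
  classical
  set R := Finset.image (fun p : Zn n × Zn n => p.1 + p.2) (S ×ˢ S') with hRdef
  have hR : ∀ μ ∈ S, ∀ ν ∈ S', μ + ν ∈ R := fun μ hμ ν hν =>
    Finset.mem_image.2 ⟨(μ, ν), Finset.mem_product.2 ⟨hμ, hν⟩, rfl⟩
  set c : Zn n → ℂ := fun ρ => ∑ μ ∈ S, ∑ ν ∈ S', if μ + ν = ρ then A μ ν * F μ * G ν else 0
    with hc
  have hgroup : ∀ X : Zn n → ℂ, ∑ ρ ∈ R, c ρ * X ρ
      = ∑ μ ∈ S, ∑ ν ∈ S', A μ ν * F μ * G ν * X (μ + ν) := by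
    intro X
    simp_rw [hc, Finset.sum_mul]
    rw [Finset.sum_comm]
    refine Finset.sum_congr rfl fun μ hμ => ?_
    rw [Finset.sum_comm]
    refine Finset.sum_congr rfl fun ν hν => ?_
    simp [ite_mul, hR μ hμ ν hν]
  have h1 : ∀ t : Rn n, ∑ μ ∈ S, ∑ ν ∈ S', A μ ν * charE t (coeZ (μ + ν)) * F μ * G ν
      = ∑ ρ ∈ R, c ρ * charE t (coeZ ρ) := by
    intro t
    rw [hgroup]
    refine Finset.sum_congr rfl fun μ _ => Finset.sum_congr rfl fun ν _ => ?_
    ring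
  simp_rw [h1]
  rw [lintegral_trigPoly]
  have hE : ∑ ρ ∈ R, ‖c ρ‖ₑ ^ 2 = ‖∑ ρ ∈ R, c ρ * (starRingEnd ℂ) (c ρ)‖ₑ := by
    simp_rw [Complex.mul_conj']
    rw [← ofReal_norm, show (∑ ρ ∈ R, (‖c ρ‖ : ℂ) ^ 2) = ((∑ ρ ∈ R, ‖c ρ‖ ^ 2 : ℝ) : ℂ) by
      push_cast; rfl, Complex.norm_real, Real.norm_of_nonneg (by positivity),
      ENNReal.ofReal_sum_of_nonneg fun _ _ => by positivity]
    simp_rw [ENNReal.ofReal_pow (norm_nonneg _), ofReal_norm]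
  have hconj : ∀ z : ℂ, ‖(starRingEnd ℂ) z‖ₑ = ‖z‖ₑ := fun z => by
    rw [← ofReal_norm, ← ofReal_norm, RCLike.norm_conj]
  have hle : ∑ ρ ∈ R, ‖c ρ‖ₑ ^ 2 ≤ (normB A * (∑ μ ∈ S, ‖F μ‖ₑ ^ 2) ^ (1 / 2 : ℝ)
      * (∑ μ ∈ S', ‖G μ‖ₑ ^ 2) ^ (1 / 2 : ℝ)) * (∑ ρ ∈ R, ‖c ρ‖ₑ ^ 2) ^ (1 / 2 : ℝ) := by
    have h2 := normB_finset_le A S S' R F G (fun ρ => (starRingEnd ℂ) (c ρ)) hR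
    rw [← hgroup fun ρ => (starRingEnd ℂ) (c ρ), ← hE] at h2
    simpa only [hconj] using h2
  have h3 := pow_le_pow_left₀ zero_le (sqrt_le_of_le_mul_sqrt (by simp) hle) 2
  rwa [sqrt_sq, mul_pow, mul_pow, sqrt_sq, sqrt_sq] at h3

end NormB

section Expansion
variable {n : ℕ}

/-- On `Q × TQ` the character `e^{2πi t·ξ}` is an absolutely convergent sum of products of
bounded continuous functions of `t` and of `ξ`. -/
lemma exists_charE_expansion (n : ℕ) {T : ℝ} (hT : 0 < T) :
    ∃ (ι : Type) (_ : Countable ι) (w : ι → ℝ) (φ ψ : ι → Rn n → ℂ),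
      (∀ i, 0 ≤ w i) ∧ Summable w ∧ (∀ i, Continuous (φ i)) ∧ (∀ i, Continuous (ψ i)) ∧
      (∀ i, ∀ t ∈ cube n 1, ‖φ i t‖ ≤ 1) ∧ (∀ i, ∀ ξ ∈ cube n T, ‖ψ i ξ‖ ≤ 1) ∧
      ∀ t ∈ cube n 1, ∀ ξ ∈ cube n T, HasSum (fun i => w i * φ i t * ψ i ξ) (charE t ξ) := by
  set w : (Σ m : ℕ, Fin m → Fin n) → ℝ := fun i => (Real.pi * T / 2) ^ i.1 / i.1.factorial with hw
  set φ : (Σ m : ℕ, Fin m → Fin n) → Rn n → ℂ := fun i t => ∏ l, ((2 * t (i.2 l) : ℝ) : ℂ) with hφ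
  set ψ : (Σ m : ℕ, Fin m → Fin n) → Rn n → ℂ :=
    fun i ξ => Complex.I ^ i.1 * ∏ l, ((2 * ξ (i.2 l) / T : ℝ) : ℂ) with hψ
  have hw0 : ∀ i, 0 ≤ w i := fun i => by
    have := Real.pi_pos
    simp only [hw]
    positivity
  have hws : Summable w := by
    rw [summable_sigma_of_nonneg hw0]
    refine ⟨fun m => (hasSum_fintype _).summable, ?_⟩
    convert Real.summable_pow_div_factorial (n * (Real.pi * T / 2)) using 2 with m
    simp [hw, tsum_fintype, mul_pow, mul_div_assoc]
  have hφ1 : ∀ i, ∀ t ∈ cube n 1, ‖φ i t‖ ≤ 1 := by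
    intro i t ht
    simp only [cube, Set.mem_pi, Set.mem_univ, true_imp_iff, Set.mem_Icc] at ht
    rw [hφ, norm_prod]
    refine Finset.prod_le_one (fun _ _ => norm_nonneg _) fun l _ => ?_
    rw [Complex.norm_real, Real.norm_eq_abs, abs_le]
    constructor <;> linarith [ht (i.2 l)]
  have hψ1 : ∀ i, ∀ ξ ∈ cube n T, ‖ψ i ξ‖ ≤ 1 := by
    intro i ξ hξ
    simp only [cube, Set.mem_pi, Set.mem_univ, true_imp_iff, Set.mem_Icc] at hξ
    rw [hψ, norm_mul, norm_pow, Complex.norm_I, one_pow, one_mul, norm_prod]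
    refine Finset.prod_le_one (fun _ _ => norm_nonneg _) fun l _ => ?_
    rw [Complex.norm_real, Real.norm_eq_abs, abs_le, le_div_iff₀ hT, div_le_iff₀ hT]
    constructor <;> linarith [hξ (i.2 l)]
  refine ⟨_, inferInstance, w, φ, ψ, hw0, hws, ?_, ?_, hφ1, hψ1, ?_⟩
  · intro i; simp only [hφ]; fun_prop
  · intro i; simp only [hψ]; fun_prop
  · intro t ht ξ hξ
    have hexp : HasSum (fun m : ℕ => ((2 * Real.pi * Complex.I) * ((∑ i, t i * ξ i : ℝ) : ℂ)) ^ m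
        / m.factorial) (charE t ξ) := by
      rw [charE, Complex.exp_eq_exp_ℂ]
      exact NormedSpace.expSeries_div_hasSum_exp _
    refine HasSum.sigma_of_hasSum hexp (fun m => ?_) ?_
    · convert hasSum_fintype _ using 1
      rw [Complex.ofReal_sum, Finset.mul_sum, Fintype.sum_pow, Finset.sum_div]
      refine Finset.sum_congr rfl fun s _ => ?_
      simp only [hw, hφ, hψ]
      have h1 : ∀ l, (2 * Real.pi * Complex.I) * ((t (s l) * ξ (s l) : ℝ) : ℂ)
          = ((Real.pi * T / 2 : ℝ) : ℂ) * Complex.I * ((2 * t (s l) : ℝ) : ℂ)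
            * ((2 * ξ (s l) / T : ℝ) : ℂ) := by
        intro l
        have : (T : ℂ) ≠ 0 := by exact_mod_cast hT.ne'
        push_cast
        field_simp
      simp_rw [h1, Finset.prod_mul_distrib]
      simp only [Finset.prod_const, Finset.card_univ, Fintype.card_fin]
      push_cast
      ring
    · refine Summable.of_norm_bounded hws fun i => ?_
      rw [norm_mul, norm_mul, Complex.norm_real, Real.norm_of_nonneg (hw0 i)]
      have h1 := hφ1 i t ht
      have h2 := hψ1 i ξ hξ
      calc w i * ‖φ i t‖ * ‖ψ i ξ‖ ≤ w i * 1 * 1 := by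
            have := hw0 i
            gcongr
        _ = w i := by ring

end Expansion

section FourierTransform
variable {n : ℕ}

/-- A Schwartz function on `ℝ^n`, transported to Euclidean space. -/
noncomputable def schwartzToEuclidean (f : SchwartzMap (Rn n) ℂ) :
    SchwartzMap (EuclideanSpace ℝ (Fin n)) ℂ :=
  SchwartzMap.compCLMOfContinuousLinearEquiv ℝ (EuclideanSpace.equiv (Fin n) ℝ) f

lemma ft_eq_fourier (f : SchwartzMap (Rn n) ℂ) (ξ : Rn n) :
    ft f ξ = (FourierTransform.fourier (schwartzToEuclidean f)) (WithLp.toLp 2 ξ) := by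
  rw [SchwartzMap.fourier_coe, Real.fourier_eq', ft,
    ← (PiLp.volume_preserving_toLp (Fin n)).integral_comp
      (MeasurableEquiv.toLp 2 (Fin n → ℝ)).measurableEmbedding]
  refine integral_congr_ae (Filter.Eventually.of_forall fun x => ?_)
  simp only [smul_eq_mul]
  congr 2
  rw [PiLp.inner_apply]
  push_cast
  simp
  simp_rw [mul_comm ((x _ : ℝ) : ℂ)]
  ring

lemma continuous_ft (f : SchwartzMap (Rn n) ℂ) : Continuous (ft f) := by
  have : ft f = fun ξ => (FourierTransform.fourier (schwartzToEuclidean f)) (WithLp.toLp 2 ξ) :=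
    funext (ft_eq_fourier f)
  rw [this]
  exact (SchwartzMap.continuous _).comp (PiLp.continuous_toLp 2 _)

lemma integrable_ft (f : SchwartzMap (Rn n) ℂ) : Integrable (ft f) := by
  have : ft f = (FourierTransform.fourier (schwartzToEuclidean f)) ∘ (WithLp.toLp 2) :=
    funext (ft_eq_fourier f)
  rw [this]
  exact (PiLp.volume_preserving_toLp (Fin n)).integrable_comp_of_integrable
    (SchwartzMap.integrable _)

lemma lintegral_sq_ft (f : SchwartzMap (Rn n) ℂ) :
    ∫⁻ ξ, ‖ft f ξ‖ₑ ^ 2 = eLpNorm f 2 volume ^ 2 := by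
  have hsq : ∀ F : SchwartzMap (EuclideanSpace ℝ (Fin n)) ℂ,
      ∫⁻ x, ‖F x‖ₑ ^ 2 = ENNReal.ofReal (∫ x, ‖F x‖ ^ 2) := fun F =>
    lintegral_enorm_sq_eq ((memLp_two_iff_integrable_sq_norm
      (SchwartzMap.continuous _).aestronglyMeasurable).1 (F.memLp 2 volume))
  have hcomp : ∀ F : SchwartzMap (EuclideanSpace ℝ (Fin n)) ℂ,
      ∫⁻ x : Rn n, ‖F (WithLp.toLp 2 x)‖ₑ ^ 2 = ∫⁻ x, ‖F x‖ₑ ^ 2 := fun F =>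
    (PiLp.volume_preserving_toLp (Fin n)).lintegral_comp
      (F.continuous.enorm.measurable.pow_const 2)
  calc ∫⁻ ξ, ‖ft f ξ‖ₑ ^ 2 = ∫⁻ x, ‖schwartzToEuclidean f x‖ₑ ^ 2 := by
        simp_rw [ft_eq_fourier]
        rw [hcomp, hsq, hsq, SchwartzMap.integral_norm_sq_fourier]
    _ = ∫⁻ x, ‖f x‖ₑ ^ 2 := (hcomp _).symm
    _ = _ := by
        rw [eLpNorm_eq_lintegral_rpow_enorm_toReal (by norm_num) (by norm_num)]
        simp only [ENNReal.toReal_ofNat, ENNReal.rpow_two, sqrt_sq]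

end FourierTransform

section Pieces
variable {n : ℕ}

/-- The frequency-localised piece `u(D - μ)` applied to the function with Fourier transform `G`. -/
noncomputable def freqPiece (u G : Rn n → ℂ) (μ : Zn n) (x : Rn n) : ℂ :=
  ∫ ξ, charE x ξ * (u (ξ - coeZ μ) * G ξ)

/-- The lattice samples of the frequency-localised pieces, modulated back to the origin and
filtered by `ψ`. -/
noncomputable def sampleCoeff (ψ u G : Rn n → ℂ) (μ k : Zn n) : ℂ :=
  ∫ ξ, charE (coeZ k) ξ * (ψ ξ * u ξ * G (ξ + coeZ μ))

lemma integrable_charE_mul {h : Rn n → ℂ} (hi : Integrable h) (x : Rn n) :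
    Integrable fun ξ => charE x ξ * h ξ :=
  hi.bdd_mul (c := 1) (continuous_charE_right _).aestronglyMeasurable
    (Filter.Eventually.of_forall fun _ => (norm_charE _ _).le)

lemma integrable_translate_mul {u G : Rn n → ℂ} (hu : Continuous u) (hG : Integrable G)
    {M : ℝ≥0} (hM : ∀ ξ, ‖u ξ‖₊ ≤ M) (μ : Zn n) :
    Integrable fun ξ => u (ξ - coeZ μ) * G ξ :=
  hG.bdd_mul (c := M) (hu.comp (continuous_sub_right _)).aestronglyMeasurable
    (Filter.Eventually.of_forall fun _ => hM _)

lemma continuous_freqPiece {u G : Rn n → ℂ} (hu : Continuous u) (hG : Integrable G)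
    {M : ℝ≥0} (hM : ∀ ξ, ‖u ξ‖₊ ≤ M) (μ : Zn n) : Continuous (freqPiece u G μ) := by
  have hi := integrable_translate_mul hu hG hM μ
  refine continuous_of_dominated (bound := fun ξ => ‖u (ξ - coeZ μ) * G ξ‖)
    (fun x => (integrable_charE_mul hi x).aestronglyMeasurable) (fun x => ?_) hi.norm ?_
  · exact Filter.Eventually.of_forall fun ξ => by rw [norm_mul, norm_charE, one_mul]
  · exact Filter.Eventually.of_forall fun ξ => (continuous_charE_left ξ).mul continuous_const

variable {T : ℝ} {u G : Rn n → ℂ} {M : ℝ≥0}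

lemma norm_filter_mul_le {ψ : Rn n → ℂ} (hψ1 : ∀ ξ ∈ cube n T, ‖ψ ξ‖ ≤ 1)
    (hs : Function.support u ⊆ cube n T) (ξ : Rn n) : ‖ψ ξ * u ξ‖ ≤ ‖u ξ‖ := by
  by_cases h : u ξ = 0
  · simp [h]
  · rw [norm_mul]
    exact mul_le_of_le_one_left (norm_nonneg _) (hψ1 ξ (hs h))

lemma integrable_filter_mul {ψ : Rn n → ℂ} (hψ : Continuous ψ) (hψ1 : ∀ ξ ∈ cube n T, ‖ψ ξ‖ ≤ 1)
    (hu : Continuous u) (hs : Function.support u ⊆ cube n T) (hG : Integrable G)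
    (hM : ∀ ξ, ‖u ξ‖₊ ≤ M) (μ : Zn n) :
    Integrable fun ξ => ψ ξ * u ξ * G (ξ + coeZ μ) :=
  (hG.comp_add_right (coeZ μ)).bdd_mul (c := M) (hψ.mul hu).aestronglyMeasurable
    (Filter.Eventually.of_forall fun ξ => (norm_filter_mul_le hψ1 hs ξ).trans (hM ξ))

lemma tsum_sq_sampleCoeff_le (hT : 0 < T) {ψ : Rn n → ℂ} (hψ : Continuous ψ)
    (hψ1 : ∀ ξ ∈ cube n T, ‖ψ ξ‖ ≤ 1) (hu : Continuous u)
    (hs : Function.support u ⊆ cube n T) (hGc : Continuous G) (hG : Integrable G)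
    (hM : ∀ ξ, ‖u ξ‖₊ ≤ M) :
    ∑' (k : Zn n) (μ : Zn n), ‖sampleCoeff ψ u G μ k‖ₑ ^ 2
      ≤ (coverZ n T).card ^ 2 * (M : ℝ≥0∞) ^ 2 * ∫⁻ ξ, ‖G ξ‖ₑ ^ 2 := by
  rw [ENNReal.tsum_comm]
  set J : ℝ≥0∞ := ((coverZ n T).card : ℝ≥0∞)
  have h1 : ∀ μ : Zn n, ∑' k : Zn n, ‖sampleCoeff ψ u G μ k‖ₑ ^ 2
      ≤ J * (M ^ 2 * ∫⁻ ξ in cube n T, ‖G (ξ + coeZ μ)‖ₑ ^ 2) := by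
    intro μ
    have hc : Continuous fun ξ => ψ ξ * u ξ * G (ξ + coeZ μ) :=
      (hψ.mul hu).mul (hGc.comp (continuous_add_const _))
    refine (tsum_sq_enorm_integral_charE_le hT hc.measurable
      (integrable_filter_mul hψ hψ1 hu hs hG hM μ) ?_).trans ?_
    · intro ξ hξ
      refine hs fun h0 => hξ ?_
      simp [h0]
    · gcongr
      rw [← lintegral_const_mul' _ _ (by simp), ← lintegral_indicator (measurableSet_cube T)]
      refine lintegral_mono fun ξ => ?_
      classical
      rw [Set.indicator_apply]
      split_ifs with h
      · rw [enorm_mul, mul_pow]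
        gcongr
        have : ‖ψ ξ * u ξ‖₊ ≤ M := (norm_filter_mul_le hψ1 hs ξ).trans (hM ξ)
        exact ENNReal.coe_le_coe.2 this
      · have : u ξ = 0 := by
          by_contra h0
          exact h (hs h0)
        simp [this]
  calc _ ≤ ∑' μ : Zn n, J * (M ^ 2 * ∫⁻ ξ in cube n T, ‖G (ξ + coeZ μ)‖ₑ ^ 2) :=
        ENNReal.tsum_le_tsum h1
    _ = J * (M ^ 2 * ∑' μ : Zn n, ∫⁻ ξ in cube n T, ‖G (ξ + coeZ μ)‖ₑ ^ 2) := by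
        rw [ENNReal.tsum_mul_left, ENNReal.tsum_mul_left]
    _ ≤ J * (M ^ 2 * (J * ∫⁻ ξ, ‖G ξ‖ₑ ^ 2)) := by
        gcongr
        exact tsum_setLIntegral_cube_le hT (φ := fun ξ => ‖G ξ‖ₑ ^ 2)
          (hGc.enorm.measurable.pow_const 2)
    _ = _ := by ring

lemma freqPiece_add_coeZ (u G : Rn n → ℂ) (μ k : Zn n) (t : Rn n) :
    freqPiece u G μ (t + coeZ k) = charE t (coeZ μ) *
      ∫ ξ, charE t ξ * (charE (coeZ k) ξ * (u ξ * G (ξ + coeZ μ))) := by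
  rw [freqPiece, ← integral_add_right_eq_self _ (coeZ μ), ← integral_const_mul]
  refine integral_congr_ae (Filter.Eventually.of_forall fun ξ => ?_)
  beta_reduce
  rw [add_sub_cancel_right, charE_add_left, charE_add_right, charE_add_right, charE_coeZ]
  ring

lemma hasSum_sampleCoeff {ι : Type*} [Countable ι] {w : ι → ℝ} {φ ψ : ι → Rn n → ℂ}
    (hw : ∀ i, 0 ≤ w i) (hws : Summable w) (hψ : ∀ i, Continuous (ψ i))
    (hφ1 : ∀ i, ∀ t ∈ cube n 1, ‖φ i t‖ ≤ 1) (hψ1 : ∀ i, ∀ ξ ∈ cube n T, ‖ψ i ξ‖ ≤ 1)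
    (hexp : ∀ t ∈ cube n 1, ∀ ξ ∈ cube n T, HasSum (fun i => w i * φ i t * ψ i ξ) (charE t ξ))
    (hu : Continuous u) (hs : Function.support u ⊆ cube n T) (hG : Integrable G)
    (hM : ∀ ξ, ‖u ξ‖₊ ≤ M) (μ k : Zn n) {t : Rn n} (ht : t ∈ cube n 1) :
    HasSum (fun i => w i * φ i t * sampleCoeff (ψ i) u G μ k)
      (∫ ξ, charE t ξ * (charE (coeZ k) ξ * (u ξ * G (ξ + coeZ μ)))) := by
  have hi : ∀ i, Integrable fun ξ =>
      w i * φ i t * (charE (coeZ k) ξ * (ψ i ξ * u ξ * G (ξ + coeZ μ))) := fun i =>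
    (integrable_charE_mul (integrable_filter_mul (hψ i) (hψ1 i) hu hs hG hM μ) _).const_mul _
  have hi0 : Integrable fun ξ => u ξ * G (ξ + coeZ μ) :=
    (hG.comp_add_right (coeZ μ)).bdd_mul (c := M) hu.aestronglyMeasurable
      (Filter.Eventually.of_forall fun _ => hM _)
  have hsum : Summable fun i =>
      ∫ ξ, ‖w i * φ i t * (charE (coeZ k) ξ * (ψ i ξ * u ξ * G (ξ + coeZ μ)))‖ := by
    refine Summable.of_nonneg_of_le (fun i => integral_nonneg fun _ => norm_nonneg _) (fun i => ?_)
      (hws.mul_right (∫ ξ, ‖u ξ * G (ξ + coeZ μ)‖))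
    rw [← integral_const_mul]
    refine integral_mono (hi i).norm (hi0.norm.const_mul _) fun ξ => ?_
    simp only
    rw [norm_mul, norm_mul, norm_mul, norm_charE, one_mul, norm_mul _ (G _), norm_mul (u ξ),
      Complex.norm_real, Real.norm_of_nonneg (hw i)]
    have h1 := hφ1 i t ht
    have h2 := norm_filter_mul_le (hψ1 i) hs ξ
    have h3 := hw i
    calc w i * ‖φ i t‖ * (‖ψ i ξ * u ξ‖ * ‖G (ξ + coeZ μ)‖)
        ≤ w i * 1 * (‖u ξ‖ * ‖G (ξ + coeZ μ)‖) := by gcongr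
      _ = _ := by rw [mul_one]
  have key := hasSum_integral_of_summable_integral_norm hi hsum
  convert key using 1
  · rfl
  · funext i
    rw [integral_const_mul, sampleCoeff]
  · refine integral_congr_ae (Filter.Eventually.of_forall fun ξ => ?_)
    beta_reduce
    by_cases h : u ξ = 0
    · simp [h]
    · rw [← (hexp t ht ξ (hs h)).tsum_eq, ← tsum_mul_right]
      refine tsum_congr fun i => ?_
      ring

lemma summable_integral_norm_translate (hT : 0 < T) (hu : Continuous u)
    (hs : Function.support u ⊆ cube n T) (hGc : Continuous G) (hG : Integrable G)
    (hM : ∀ ξ, ‖u ξ‖₊ ≤ M) :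
    Summable fun μ : Zn n => ∫ ξ, ‖u (ξ - coeZ μ) * G ξ‖ := by
  have hi := integrable_translate_mul hu hG hM
  have hle : ∑' μ : Zn n, ∫⁻ ξ, ‖u (ξ - coeZ μ) * G ξ‖ₑ
      ≤ M * ((coverZ n T).card * ∫⁻ ξ, ‖G ξ‖ₑ) := by
    refine le_trans ?_ (mul_le_mul_right (tsum_setLIntegral_cube_le hT
      (φ := fun ξ => ‖G ξ‖ₑ) hGc.enorm.measurable) _)
    rw [← ENNReal.tsum_mul_left]
    refine ENNReal.tsum_le_tsum fun μ => ?_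
    rw [← lintegral_add_right_eq_self _ (coeZ μ), ← lintegral_const_mul' _ _ (by simp),
      ← lintegral_indicator (measurableSet_cube T)]
    refine lintegral_mono fun ξ => ?_
    classical
    rw [Set.indicator_apply, add_sub_cancel_right]
    split_ifs with h
    · rw [enorm_mul]
      gcongr
      exact ENNReal.coe_le_coe.2 (hM ξ)
    · have : u ξ = 0 := by
        by_contra h0
        exact h (hs h0)
      simp [this]
  have hne : ∑' μ : Zn n, ∫⁻ ξ, ‖u (ξ - coeZ μ) * G ξ‖ₑ ≠ ∞ := by
    refine (hle.trans_lt ?_).ne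
    exact ENNReal.mul_lt_top ENNReal.coe_lt_top
      (ENNReal.mul_lt_top (ENNReal.natCast_lt_top _) hG.hasFiniteIntegral)
  refine (ENNReal.summable_toReal hne).congr fun μ => ?_
  rw [integral_norm_eq_lintegral_enorm (hi μ).aestronglyMeasurable]

end Pieces

section Operator
variable {n : ℕ} {T : ℝ} {u v : Rn n → ℂ} {M N : ℝ≥0}

lemma hasSum_Tbil (hT : 0 < T) (hu : Continuous u) (hv : Continuous v)
    (hsu : Function.support u ⊆ cube n T) (hsv : Function.support v ⊆ cube n T)
    (hM : ∀ ξ, ‖u ξ‖₊ ≤ M) (hN : ∀ ξ, ‖v ξ‖₊ ≤ N) {A : Zn n → Zn n → ℂ} (hA : IsLinftyMatrix A)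
    (f g : SchwartzMap (Rn n) ℂ) (x : Rn n) :
    HasSum (fun p : Zn n × Zn n => A p.1 p.2 *
        (freqPiece u (ft f) p.1 x * freqPiece v (ft g) p.2 x))
      (Tbil (sigmaA A fun p => u p.1 * v p.2) f g x) := by
  obtain ⟨C, hC⟩ := hA
  have hiu := integrable_translate_mul hu (integrable_ft f) hM
  have hiv := integrable_translate_mul hv (integrable_ft g) hN
  have hi : ∀ p : Zn n × Zn n, Integrable fun q : Rn n × Rn n => A p.1 p.2 *
      ((charE x q.1 * (u (q.1 - coeZ p.1) * ft f q.1)) *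
        (charE x q.2 * (v (q.2 - coeZ p.2) * ft g q.2))) := fun p =>
    ((integrable_charE_mul (hiu p.1) x).mul_prod (integrable_charE_mul (hiv p.2) x)).const_mul _
  have hsum : Summable fun p : Zn n × Zn n => ∫ q : Rn n × Rn n, ‖A p.1 p.2 *
      ((charE x q.1 * (u (q.1 - coeZ p.1) * ft f q.1)) *
        (charE x q.2 * (v (q.2 - coeZ p.2) * ft g q.2)))‖ := by
    have hsu' := summable_integral_norm_translate hT hu hsu (continuous_ft f) (integrable_ft f) hM
    have hsv' := summable_integral_norm_translate hT hv hsv (continuous_ft g) (integrable_ft g) hN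
    have hs := (hsu'.mul_of_nonneg hsv' (fun _ => integral_nonneg fun _ => norm_nonneg _)
      (fun _ => integral_nonneg fun _ => norm_nonneg _)).mul_left C
    refine Summable.of_nonneg_of_le (fun p => integral_nonneg fun _ => norm_nonneg _)
      (fun p => ?_) hs
    have : ∀ q : Rn n × Rn n, ‖A p.1 p.2 * ((charE x q.1 * (u (q.1 - coeZ p.1) * ft f q.1)) *
        (charE x q.2 * (v (q.2 - coeZ p.2) * ft g q.2)))‖
        = ‖A p.1 p.2‖ * (‖u (q.1 - coeZ p.1) * ft f q.1‖ * ‖v (q.2 - coeZ p.2) * ft g q.2‖) := by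
      intro q
      rw [norm_mul, norm_mul, norm_mul (charE x q.1), norm_mul (charE x q.2), norm_charE,
        norm_charE, one_mul, one_mul]
    simp_rw [this]
    rw [integral_const_mul, Measure.volume_eq_prod,
      integral_prod_mul (fun ξ => ‖u (ξ - coeZ p.1) * ft f ξ‖)
        (fun ξ => ‖v (ξ - coeZ p.2) * ft g ξ‖)]
    exact mul_le_mul_of_nonneg_right (hC _ _) (mul_nonneg (integral_nonneg fun _ => norm_nonneg _)
      (integral_nonneg fun _ => norm_nonneg _))
  convert hasSum_integral_of_summable_integral_norm hi hsum using 1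
  · rfl
  · funext p
    rw [integral_const_mul, Measure.volume_eq_prod,
      integral_prod_mul (fun ξ => charE x ξ * (u (ξ - coeZ p.1) * ft f ξ))
        (fun ξ => charE x ξ * (v (ξ - coeZ p.2) * ft g ξ))]
    rfl
  · rw [Tbil]
    refine integral_congr_ae (Filter.Eventually.of_forall fun q => ?_)
    beta_reduce
    have h1 : Complex.exp ((2 * Real.pi * Complex.I) * ((∑ i, x i * (q.1 i + q.2 i) : ℝ) : ℂ))
        = charE x q.1 * charE x q.2 := by
      rw [← charE_add_right]; rfl
    rw [h1, sigmaA, ← tsum_mul_left, ← tsum_mul_right, ← tsum_mul_right]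
    refine tsum_congr fun p => ?_
    ring

end Operator

section LocalEstimate
variable {n : ℕ} {ι : Type*} {w : ι → ℝ} {φ : ι → Rn n → ℂ}

lemma hasSum_mul_prod {f g : ι → ℂ} {a b : ℂ} (hf : HasSum f a) (hg : HasSum g b) :
    HasSum (fun p : ι × ι => f p.1 * g p.2) (a * b) := by
  have h1 : Summable fun i => ‖f i‖ := hf.summable.norm
  have h2 : Summable fun i => ‖g i‖ := hg.summable.norm
  have h3 : Summable fun p : ι × ι => f p.1 * g p.2 := summable_mul_of_summable_norm h1 h2
  exact hf.mul hg h3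

lemma hasSum_bilinear_expansion {F G : ι → Zn n → ℂ} {a b : Zn n → ℂ} {t : Rn n}
    {S S' : Finset (Zn n)} (A : Zn n → Zn n → ℂ)
    (ha : ∀ μ, HasSum (fun i => w i * φ i t * F i μ) (a μ))
    (hb : ∀ μ, HasSum (fun i => w i * φ i t * G i μ) (b μ)) :
    HasSum (fun p : ι × ι => (w p.1 * φ p.1 t) * (w p.2 * φ p.2 t) *
        ∑ μ ∈ S, ∑ ν ∈ S', A μ ν * charE t (coeZ (μ + ν)) * F p.1 μ * G p.2 ν)
      (∑ μ ∈ S, ∑ ν ∈ S', A μ ν * (charE t (coeZ μ) * a μ * (charE t (coeZ ν) * b ν))) := by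
  have key : ∀ μ ν, HasSum (fun p : ι × ι => (w p.1 * φ p.1 t : ℂ) * (w p.2 * φ p.2 t) *
      (A μ ν * charE t (coeZ (μ + ν)) * F p.1 μ * G p.2 ν))
      (A μ ν * (charE t (coeZ μ) * a μ * (charE t (coeZ ν) * b ν))) := by
    intro μ ν
    have h := hasSum_mul_prod (ha μ) (hb ν)
    have e2 : A μ ν * (charE t (coeZ μ) * a μ * (charE t (coeZ ν) * b ν))
        = A μ ν * (charE t (coeZ μ) * charE t (coeZ ν)) * (a μ * b ν) := by ring
    rw [e2]
    refine (h.mul_left (A μ ν * (charE t (coeZ μ) * charE t (coeZ ν)))).congr_fun fun p => ?_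
    rw [coeZ_add, charE_add_right]
    ring
  refine (hasSum_sum (s := S) fun μ _ => hasSum_sum (s := S') fun ν _ => key μ ν).congr_fun
    fun p => ?_
  simp_rw [Finset.mul_sum]

lemma lintegral_sq_bilinear_expansion_le [Countable ι] {F G : ι → Zn n → ℂ} {a b : Zn n → Rn n → ℂ}
    (A : Zn n → Zn n → ℂ) (S S' : Finset (Zn n)) (hw : ∀ i, 0 ≤ w i)
    (hφ1 : ∀ i, ∀ t ∈ cube n 1, ‖φ i t‖ ≤ 1)
    (ha : ∀ μ, ∀ t ∈ cube n 1, HasSum (fun i => w i * φ i t * F i μ) (a μ t))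
    (hb : ∀ μ, ∀ t ∈ cube n 1, HasSum (fun i => w i * φ i t * G i μ) (b μ t)) :
    ∫⁻ t in cube n 1, ‖∑ μ ∈ S, ∑ ν ∈ S',
        A μ ν * (charE t (coeZ μ) * a μ t * (charE t (coeZ ν) * b ν t))‖ₑ ^ 2
      ≤ normB A ^ 2 *
        ((∑' i, ENNReal.ofReal (w i)) * ∑' i, ENNReal.ofReal (w i) * ∑ μ ∈ S, ‖F i μ‖ₑ ^ 2) *
        ((∑' i, ENNReal.ofReal (w i)) * ∑' i, ENNReal.ofReal (w i) * ∑ μ ∈ S', ‖G i μ‖ₑ ^ 2) := by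
  set W := fun i => ENNReal.ofReal (w i) with hW
  set P : ι × ι → Rn n → ℂ := fun p t =>
    ∑ μ ∈ S, ∑ ν ∈ S', A μ ν * charE t (coeZ (μ + ν)) * F p.1 μ * G p.2 ν with hP
  have hPc : ∀ p, Continuous (P p) := fun p => by
    refine continuous_finsetSum _ fun μ _ => continuous_finsetSum _ fun ν _ => ?_
    exact ((continuous_const.mul (continuous_charE_left _)).mul continuous_const).mul
      continuous_const
  have hmeas : ∀ p, Measurable fun t => W p.1 * W p.2 * ‖P p t‖ₑ ^ 2 := fun p =>
    ((hPc p).enorm.measurable.pow_const 2).const_mul _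
  have hWn : ∀ i, ∀ t ∈ cube n 1, ‖(w i : ℂ) * φ i t‖ₑ ≤ W i := fun i t ht => by
    rw [← ofReal_norm]
    refine ENNReal.ofReal_le_ofReal ?_
    rw [norm_mul, Complex.norm_real, Real.norm_of_nonneg (hw i)]
    exact mul_le_of_le_one_right (hw i) (hφ1 i t ht)
  have hWW : ∑' p : ι × ι, W p.1 * W p.2 = (∑' i, W i) * ∑' i, W i := by
    rw [ENNReal.tsum_prod', ← ENNReal.tsum_mul_right]
    simp_rw [ENNReal.tsum_mul_left]
  have hpt : ∀ t ∈ cube n 1, ‖∑ μ ∈ S, ∑ ν ∈ S',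
        A μ ν * (charE t (coeZ μ) * a μ t * (charE t (coeZ ν) * b ν t))‖ₑ ^ 2
      ≤ (∑' i, W i) * (∑' i, W i) * ∑' p : ι × ι, W p.1 * W p.2 * ‖P p t‖ₑ ^ 2 := by
    intro t ht
    rw [← (hasSum_bilinear_expansion A (fun μ => ha μ t ht) fun μ => hb μ t ht).tsum_eq, ← hWW]
    refine le_trans ?_ (tsum_weighted_sq_le (fun p : ι × ι => W p.1 * W p.2) fun p => ‖P p t‖ₑ)
    gcongr
    refine enorm_tsum_le_tsum_enorm.trans (ENNReal.tsum_le_tsum fun p => ?_)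
    rw [enorm_mul, enorm_mul]
    gcongr
    · exact hWn _ _ ht
    · exact hWn _ _ ht
  calc _ ≤ ∫⁻ t in cube n 1,
        (∑' i, W i) * (∑' i, W i) * ∑' p : ι × ι, W p.1 * W p.2 * ‖P p t‖ₑ ^ 2 :=
        setLIntegral_mono' (measurableSet_cube 1) hpt
    _ = (∑' i, W i) * (∑' i, W i) *
          ∑' p : ι × ι, W p.1 * W p.2 * ∫⁻ t in cube n 1, ‖P p t‖ₑ ^ 2 := by
        rw [lintegral_const_mul _ (Measurable.tsum hmeas),
          lintegral_tsum fun p => (hmeas p).aemeasurable]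
        congr 2
        funext p
        rw [lintegral_const_mul _ ((hPc p).enorm.measurable.pow_const 2)]
    _ ≤ (∑' i, W i) * (∑' i, W i) * ∑' p : ι × ι, W p.1 * W p.2 *
          (normB A ^ 2 * (∑ μ ∈ S, ‖F p.1 μ‖ₑ ^ 2) * ∑ ν ∈ S', ‖G p.2 ν‖ₑ ^ 2) := by
        gcongr with p
        exact lintegral_bilinear_trigPoly_le A S S' (F p.1) (G p.2)
    _ = (∑' i, W i) * (∑' i, W i) * (normB A ^ 2 *
          ((∑' i, W i * ∑ μ ∈ S, ‖F i μ‖ₑ ^ 2) * ∑' j, W j * ∑ ν ∈ S', ‖G j ν‖ₑ ^ 2)) := by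
        congr 1
        rw [← ENNReal.tsum_mul_right, ← ENNReal.tsum_mul_left, ENNReal.tsum_prod']
        refine tsum_congr fun i => ?_
        rw [← ENNReal.tsum_mul_left, ← ENNReal.tsum_mul_left]
        refine tsum_congr fun j => ?_
        simp only
        ring
    _ = _ := by ring

end LocalEstimate

section Main
variable {n : ℕ} {T : ℝ} {u v : Rn n → ℂ} {M N : ℝ≥0}
  {ι : Type*} {w : ι → ℝ} {φ ψ : ι → Rn n → ℂ}

/-- The weighted energy of the filtered samples at the lattice point `k`. -/
noncomputable def sampleEnergy (w : ι → ℝ) (ψ : ι → Rn n → ℂ) (u G : Rn n → ℂ) (k : Zn n) :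
    ℝ≥0∞ :=
  (∑' i, ENNReal.ofReal (w i)) *
    ∑' i, ENNReal.ofReal (w i) * ∑' μ, ‖sampleCoeff (ψ i) u G μ k‖ₑ ^ 2

lemma tsum_sampleEnergy_le (hT : 0 < T) (hψ : ∀ i, Continuous (ψ i))
    (hψ1 : ∀ i, ∀ ξ ∈ cube n T, ‖ψ i ξ‖ ≤ 1) (hu : Continuous u)
    (hs : Function.support u ⊆ cube n T) (hM : ∀ ξ, ‖u ξ‖₊ ≤ M) (f : SchwartzMap (Rn n) ℂ) :
    ∑' k, sampleEnergy w ψ u (ft f) k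
      ≤ (∑' i, ENNReal.ofReal (w i)) ^ 2 * ((coverZ n T).card ^ 2 * (M : ℝ≥0∞) ^ 2 *
        eLpNorm (⇑f) 2 volume ^ 2) := by
  simp only [sampleEnergy]
  rw [ENNReal.tsum_mul_left, ENNReal.tsum_comm, pow_two, mul_assoc]
  gcongr
  rw [← ENNReal.tsum_mul_right]
  refine ENNReal.tsum_le_tsum fun i => ?_
  rw [ENNReal.tsum_mul_left, ← lintegral_sq_ft]
  gcongr
  exact tsum_sq_sampleCoeff_le hT (hψ i) (hψ1 i) hu hs (continuous_ft f) (integrable_ft f) hM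

lemma setLIntegral_sq_Tbil_le [Countable ι] (hT : 0 < T) (hw : ∀ i, 0 ≤ w i) (hws : Summable w)
    (hψ : ∀ i, Continuous (ψ i))
    (hφ1 : ∀ i, ∀ t ∈ cube n 1, ‖φ i t‖ ≤ 1) (hψ1 : ∀ i, ∀ ξ ∈ cube n T, ‖ψ i ξ‖ ≤ 1)
    (hexp : ∀ t ∈ cube n 1, ∀ ξ ∈ cube n T, HasSum (fun i => w i * φ i t * ψ i ξ) (charE t ξ))
    (hu : Continuous u) (hv : Continuous v)
    (hsu : Function.support u ⊆ cube n T) (hsv : Function.support v ⊆ cube n T)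
    (hM : ∀ ξ, ‖u ξ‖₊ ≤ M) (hN : ∀ ξ, ‖v ξ‖₊ ≤ N) {A : Zn n → Zn n → ℂ} (hA : IsLinftyMatrix A)
    (f g : SchwartzMap (Rn n) ℂ) (k : Zn n) :
    ∫⁻ t in cube n 1, ‖Tbil (sigmaA A fun p => u p.1 * v p.2) f g (t + coeZ k)‖ₑ ^ 2
      ≤ normB A ^ 2 * sampleEnergy w ψ u (ft f) k * sampleEnergy w ψ v (ft g) k := by
  set P : Finset (Zn n) → Rn n → ℂ := fun S t => ∑ p ∈ S ×ˢ S, A p.1 p.2 *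
      (freqPiece u (ft f) p.1 (t + coeZ k) * freqPiece v (ft g) p.2 (t + coeZ k)) with hP
  have hlim : ∀ t, Filter.Tendsto (fun S => ‖P S t‖ₑ ^ 2) Filter.atTop
      (nhds (‖Tbil (sigmaA A fun p => u p.1 * v p.2) f g (t + coeZ k)‖ₑ ^ 2)) := fun t => by
    have h1 := hasSum_Tbil hT hu hv hsu hsv hM hN hA f g (t + coeZ k)
    have h2 : Filter.Tendsto (fun S : Finset (Zn n) => S ×ˢ S) Filter.atTop Filter.atTop :=
      Filter.tendsto_finsetProd_atTop.comp Filter.tendsto_atTop_diagonal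
    rw [HasSum, SummationFilter.unconditional_filter] at h1
    have h3 : Filter.Tendsto (fun S => P S t) Filter.atTop _ := h1.comp h2
    exact ((ENNReal.continuous_pow 2).tendsto _).comp h3.enorm
  have hPc : ∀ S, Continuous (P S) := fun S => by
    refine continuous_finsetSum _ fun p _ => continuous_const.mul (Continuous.mul ?_ ?_)
    · exact (continuous_freqPiece hu (integrable_ft f) hM _).comp (continuous_add_const _)
    · exact (continuous_freqPiece hv (integrable_ft g) hN _).comp (continuous_add_const _)
  have hbound : ∀ S, ∫⁻ t in cube n 1, ‖P S t‖ₑ ^ 2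
      ≤ normB A ^ 2 * sampleEnergy w ψ u (ft f) k * sampleEnergy w ψ v (ft g) k := fun S => by
    have h := lintegral_sq_bilinear_expansion_le (w := w) (φ := φ)
      (F := fun i μ => sampleCoeff (ψ i) u (ft f) μ k)
      (G := fun i μ => sampleCoeff (ψ i) v (ft g) μ k) A S S hw hφ1
      (fun μ t ht => hasSum_sampleCoeff hw hws hψ hφ1 hψ1 hexp hu hsu (integrable_ft f) hM μ k ht)
      (fun μ t ht => hasSum_sampleCoeff hw hws hψ hφ1 hψ1 hexp hv hsv (integrable_ft g) hN μ k ht)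
    simp only [hP, Finset.sum_product, freqPiece_add_coeZ]
    refine h.trans ?_
    unfold sampleEnergy
    gcongr
    · exact ENNReal.sum_le_tsum _
    · exact ENNReal.sum_le_tsum _
  calc _ = ∫⁻ t in cube n 1, Filter.liminf (fun S => ‖P S t‖ₑ ^ 2) Filter.atTop :=
        lintegral_congr fun t => (hlim t).liminf_eq.symm
    _ ≤ Filter.liminf (fun S => ∫⁻ t in cube n 1, ‖P S t‖ₑ ^ 2) Filter.atTop :=
        lintegral_liminf_le' fun S => ((hPc S).enorm.measurable.pow_const 2).aemeasurable
    _ ≤ _ := Filter.liminf_le_of_le (by isBoundedDefault) fun b hb => by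
        obtain ⟨S, hS⟩ := hb.exists
        exact hS.trans (hbound S)

lemma tsum_localL2_Tbil_le [Countable ι] (hT : 0 < T) (hw : ∀ i, 0 ≤ w i) (hws : Summable w)
    (hψ : ∀ i, Continuous (ψ i))
    (hφ1 : ∀ i, ∀ t ∈ cube n 1, ‖φ i t‖ ≤ 1) (hψ1 : ∀ i, ∀ ξ ∈ cube n T, ‖ψ i ξ‖ ≤ 1)
    (hexp : ∀ t ∈ cube n 1, ∀ ξ ∈ cube n T, HasSum (fun i => w i * φ i t * ψ i ξ) (charE t ξ))
    (hu : Continuous u) (hv : Continuous v)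
    (hsu : Function.support u ⊆ cube n T) (hsv : Function.support v ⊆ cube n T)
    (hM : ∀ ξ, ‖u ξ‖₊ ≤ M) (hN : ∀ ξ, ‖v ξ‖₊ ≤ N) {A : Zn n → Zn n → ℂ} (hA : IsLinftyMatrix A)
    (f g : SchwartzMap (Rn n) ℂ) :
    ∑' k, localL2 (Tbil (sigmaA A fun p => u p.1 * v p.2) f g) k
      ≤ (∑' i, ENNReal.ofReal (w i)) ^ 2 * (coverZ n T).card ^ 2 * M * N * normB A *
        eLpNorm (⇑f) 2 volume * eLpNorm (⇑g) 2 volume := by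
  have hloc : ∀ k, localL2 (Tbil (sigmaA A fun p => u p.1 * v p.2) f g) k
      ≤ normB A * (sampleEnergy w ψ u (ft f) k ^ (1 / 2 : ℝ) *
        sampleEnergy w ψ v (ft g) k ^ (1 / 2 : ℝ)) := fun k => by
    refine (ENNReal.rpow_le_rpow (setLIntegral_sq_Tbil_le hT hw hws hψ hφ1 hψ1 hexp hu hv hsu hsv
      hM hN hA f g k) (by norm_num)).trans_eq ?_
    rw [ENNReal.mul_rpow_of_nonneg _ _ (by norm_num), ENNReal.mul_rpow_of_nonneg _ _ (by norm_num),
      sq_sqrt, mul_assoc]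
  have hsqrt : ∀ {u : Rn n → ℂ} {M : ℝ≥0} (f : SchwartzMap (Rn n) ℂ), Continuous u →
      Function.support u ⊆ cube n T → (∀ ξ, ‖u ξ‖₊ ≤ M) →
      (∑' k, sampleEnergy w ψ u (ft f) k) ^ (1 / 2 : ℝ) ≤ (∑' i, ENNReal.ofReal (w i)) *
        (coverZ n T).card * M * eLpNorm (⇑f) 2 volume := fun f hu hs hM => by
    rw [← sq_sqrt ((∑' i, ENNReal.ofReal (w i)) * _ * _ * _)]
    refine ENNReal.rpow_le_rpow ((tsum_sampleEnergy_le hT hψ hψ1 hu hs hM f).trans_eq ?_)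
      (by norm_num)
    ring
  calc _ ≤ ∑' k, normB A * (sampleEnergy w ψ u (ft f) k ^ (1 / 2 : ℝ) *
        sampleEnergy w ψ v (ft g) k ^ (1 / 2 : ℝ)) := ENNReal.tsum_le_tsum hloc
    _ ≤ normB A * ((∑' k, sampleEnergy w ψ u (ft f) k) ^ (1 / 2 : ℝ) *
          (∑' k, sampleEnergy w ψ v (ft g) k) ^ (1 / 2 : ℝ)) := by
        rw [ENNReal.tsum_mul_left]
        gcongr
        exact tsum_sqrt_mul_sqrt_le _ _
    _ ≤ normB A * (((∑' i, ENNReal.ofReal (w i)) * (coverZ n T).card * M *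
          eLpNorm (⇑f) 2 volume) * ((∑' i, ENNReal.ofReal (w i)) * (coverZ n T).card * N *
          eLpNorm (⇑g) 2 volume)) := by
        gcongr
        · exact hsqrt f hu hsu hM
        · exact hsqrt g hv hsv hN
    _ = _ := by ring

end Main

lemma IsCcInfty.supNorm_ne_top {E : Type*} [NormedAddCommGroup E] [NormedSpace ℝ E] {u : E → ℂ}
    (hu : IsCcInfty u) : supNorm u ≠ ∞ := by
  obtain ⟨C, hC⟩ := hu.2.exists_bound_of_continuous hu.1.continuous
  refine ((iSup_le fun x => ?_ : supNorm u ≤ ENNReal.ofReal C).trans_lt ENNReal.ofReal_lt_top).ne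
  exact (ofReal_norm (u x)).symm.trans_le (ENNReal.ofReal_le_ofReal (hC x))

lemma IsCcInfty.nnnorm_le_supNorm {E : Type*} [NormedAddCommGroup E] [NormedSpace ℝ E] {u : E → ℂ}
    (hu : IsCcInfty u) (x : E) : ‖u x‖₊ ≤ (supNorm u).toNNReal := by
  rw [← ENNReal.coe_le_coe, ENNReal.coe_toNNReal hu.supNorm_ne_top]
  exact le_iSup (fun x => (‖u x‖₊ : ℝ≥0∞)) x

lemma amalgamNorm_one {n : ℕ} (h : Rn n → ℂ) : amalgamNorm 1 h = ∑' k, localL2 h k := by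
  simp [amalgamNorm]

/-- the upper bound for product bumps `Φ(ξ,η) = u(ξ)v(η)` with
`supp u, supp v ⊂ TQ`, with constant depending only on `n` and `T`. -/
theorem statement8 (n : ℕ) (T : ℝ) (hT : 0 < T) :
    ∃ c : ℝ≥0∞, c < ∞ ∧
      ∀ u v : Rn n → ℂ, IsCcInfty u → IsCcInfty v →
        Function.support u ⊆ cube n T → Function.support v ⊆ cube n T →
        ∀ A : Zn n → Zn n → ℂ, IsLinftyMatrix A →
          multNorm 1 (sigmaA A (fun p : Rn n × Rn n => u p.1 * v p.2))
            ≤ c * supNorm u * supNorm v * normB A := by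
  obtain ⟨ι, _, w, φ, ψ, hw, hws, -, hψ, hφ1, hψ1, hexp⟩ := exists_charE_expansion n hT
  refine ⟨(∑' i, ENNReal.ofReal (w i)) ^ 2 * (coverZ n T).card ^ 2, ?_, ?_⟩
  · exact ENNReal.mul_lt_top (ENNReal.pow_lt_top hws.tsum_ofReal_lt_top)
      (ENNReal.pow_lt_top (ENNReal.natCast_lt_top _))
  · intro u v hu hv hsu hsv A hA
    refine iSup_le fun f => iSup_le fun g => iSup_le fun hf => iSup_le fun hg => ?_
    have h := tsum_localL2_Tbil_le hT hw hws hψ hφ1 hψ1 hexp hu.1.continuous hv.1.continuous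
      hsu hsv hu.nnnorm_le_supNorm hv.nnnorm_le_supNorm hA f g
    rwa [hf, hg, mul_one, mul_one, ENNReal.coe_toNNReal hu.supNorm_ne_top,
      ENNReal.coe_toNNReal hv.supNorm_ne_top, ← amalgamNorm_one] at h
end

section
/- Let φ ∈ C_c^∞(ℝ) satisfy supp φ ⊂ [-1,1] and φ(0) ≠ 0. Then φ satisfies condition (A) with d = 1; that is, there exists θ ∈ C_c^∞(ℝ) such that ∫_ℝ θ(x) φ(x−j) dx = 1 for j = 0 and = 0 for every j ∈ ℤ∖{0}. -/
open MeasureTheory Complex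
open scoped ENNReal NNReal

/-- The space of smooth complex-valued functions with compact support contained in `U`. -/
def testFunctions (U : Set ℝ) : Submodule ℂ (ℝ → ℂ) where
  carrier := {θ | ContDiff ℝ (⊤ : ℕ∞) θ ∧ HasCompactSupport θ ∧ tsupport θ ⊆ U}
  zero_mem' := ⟨contDiff_const, HasCompactSupport.zero, by simp [tsupport]⟩
  add_mem' := fun ha hb => ⟨ha.1.add hb.1, ha.2.1.add hb.2.1,
    (tsupport_add _ _).trans (Set.union_subset ha.2.2 hb.2.2)⟩
  smul_mem' := fun c _ ha => ⟨contDiff_const.smul ha.1, ha.2.1.smul_left (f := fun _ => c),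
    (tsupport_smul_subset_right (fun _ => c) _).trans ha.2.2⟩

theorem integrable_testFunctions_mul {U : Set ℝ} (θ : testFunctions U) {g : ℝ → ℂ}
    (hg : Continuous g) : Integrable fun x => θ.1 x * g x :=
  (θ.2.1.continuous.mul hg).integrable_of_hasCompactSupport θ.2.2.1.mul_right

/-- Integration against a continuous function, as a linear functional on test functions. -/
noncomputable def testPairing (U : Set ℝ) (g : ℝ → ℂ) (hg : Continuous g) : testFunctions U →ₗ[ℂ] ℂ where
  toFun θ := ∫ x, θ.1 x * g x
  map_add' a b := by
    rw [← integral_add (integrable_testFunctions_mul a hg) (integrable_testFunctions_mul b hg)]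
    simp [add_mul]
  map_smul' c a := by
    simp [mul_assoc, integral_const_mul]

/-- A continuous function which annihilates all test functions on an open set vanishes there. -/
theorem eqOn_zero_of_testPairing_eq_zero {U : Set ℝ} (hU : IsOpen U) {g : ℝ → ℂ}
    (hg : Continuous g) (h : testPairing U g hg = 0) : Set.EqOn g 0 U := by
  have hae : ∀ᵐ x, x ∈ U → g x = 0 := by
    refine hU.ae_eq_zero_of_integral_contDiff_smul_eq_zero (hg.locallyIntegrable.locallyIntegrableOn U)
      fun ψ hψ hψc hψU => ?_
    have hsub : tsupport (fun x => (ψ x : ℂ)) ⊆ tsupport ψ :=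
      closure_mono fun x hx h => hx (by simp [h])
    have := LinearMap.congr_fun h
      ⟨fun x => (ψ x : ℂ), ofRealCLM.contDiff.comp hψ, hψc.comp_left ofReal_zero,
        hsub.trans hψU⟩
    simpa [testPairing] using this
  exact Measure.eqOn_open_of_ae_eq ((ae_restrict_iff' hU.measurableSet).2 hae) hU
    hg.continuousOn continuousOn_const

/-- If finitely many continuous functions vanish at a point of an open set where a further
continuous function `f` does not, then some test function on the open set annihilates all of them
and has integral one against `f`. -/
theorem exists_testFunction_integral_eq_one {ι : Type*} [Finite ι] {U : Set ℝ} (hU : IsOpen U)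
    {f : ℝ → ℂ} (hf : Continuous f) {g : ι → ℝ → ℂ} (hg : ∀ i, Continuous (g i)) {x₀ : ℝ}
    (hx₀ : x₀ ∈ U) (hfx : f x₀ ≠ 0) (hgx : ∀ i, g i x₀ = 0) :
    ∃ θ ∈ testFunctions U, (∫ x, θ x * f x) = 1 ∧ ∀ i, (∫ x, θ x * g i x) = 0 := by
  have := Fintype.ofFinite ι
  by_cases hker : ⨅ i, LinearMap.ker (testPairing U (g i) (hg i)) ≤
      LinearMap.ker (testPairing U f hf)
  · obtain ⟨c, hc⟩ := (Submodule.mem_span_range_iff_exists_fun ℂ).1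
      (mem_span_of_iInf_ker_le_ker hker)
    have hd : Continuous fun x => f x - ∑ i, c i * g i x := by fun_prop
    have hzero : testPairing U _ hd = 0 := by
      ext θ
      have hint : ∀ i, Integrable fun x => c i * (θ.1 x * g i x) := fun i =>
        (integrable_testFunctions_mul θ (hg i)).const_mul _
      have heq : (fun x => θ.1 x * (f x - ∑ i, c i * g i x)) =
          fun x => θ.1 x * f x - ∑ i, c i * (θ.1 x * g i x) := by
        ext x
        rw [mul_sub, Finset.mul_sum]
        simp only [mul_left_comm]
      have hcθ := LinearMap.congr_fun hc θ
      simp only [testPairing, LinearMap.sum_apply, LinearMap.smul_apply, LinearMap.coe_mk,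
        AddHom.coe_mk, smul_eq_mul, LinearMap.zero_apply] at hcθ ⊢
      rw [heq, integral_sub (integrable_testFunctions_mul θ hf)
        (integrable_finsetSum _ fun i _ => hint i), integral_finsetSum _ fun i _ => hint i]
      simp only [integral_const_mul]
      rw [hcθ, sub_self]
    have := eqOn_zero_of_testPairing_eq_zero hU hd hzero hx₀
    simp [hgx, hfx] at this
  · obtain ⟨θ, hθg, hθf⟩ := SetLike.not_le_iff_exists.1 hker
    simp only [Submodule.mem_iInf, LinearMap.mem_ker] at hθg hθf
    refine ⟨_, ((testPairing U f hf θ)⁻¹ • θ).2, ?_, fun i => ?_⟩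
    · change testPairing U f hf (_ • θ) = 1
      rw [map_smul, smul_eq_mul, inv_mul_cancel₀ hθf]
    · change testPairing U (g i) (hg i) (_ • θ) = 0
      rw [map_smul, hθg, smul_zero]

/-- a bump `φ ∈ C_c^∞(ℝ)` with `supp φ ⊂ [-1,1]` and `φ(0) ≠ 0`
satisfies condition (A) (with `d = 1`). -/
theorem statement11 (φ : ℝ → ℂ) (hsm : ContDiff ℝ (⊤ : ℕ∞) φ) (hc : HasCompactSupport φ)
    (hsupp : Function.support φ ⊆ Set.Icc (-1 : ℝ) 1) (h0 : φ 0 ≠ 0) :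
    ∃ θ : ℝ → ℂ, ContDiff ℝ (⊤ : ℕ∞) θ ∧ HasCompactSupport θ ∧
      ∀ j : ℤ, (∫ x : ℝ, θ x * φ (x - (j : ℝ))) = if j = 0 then 1 else 0 := by
  have hsupp' : Function.support φ ⊆ Set.Ioo (-1 : ℝ) 1 := by
    rw [← interior_Icc]
    exact interior_maximal hsupp hsm.continuous.isOpen_support
  have hvanish : ∀ y : ℝ, 1 ≤ |y| → φ y = 0 := fun y hy => by
    by_contra hne
    exact absurd (abs_lt.2 (hsupp' hne)) hy.not_gt
  obtain ⟨θ, ⟨hθ, hθc, hθU⟩, hone, hzero⟩ := exists_testFunction_integral_eq_one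
    (U := Set.Ioo (-1 : ℝ) 1) isOpen_Ioo hsm.continuous
    (g := fun (j : ({-1, 1} : Finset ℤ)) x => φ (x - (j : ℤ)))
    (fun j => hsm.continuous.comp (continuous_sub_right _)) (x₀ := 0) (by simp) h0
    (by
      rintro ⟨j, hj⟩
      refine hvanish _ ?_
      simp only [Finset.mem_insert, Finset.mem_singleton] at hj
      rcases hj with rfl | rfl <;> simp)
  refine ⟨θ, hθ, hθc, fun j => ?_⟩
  split_ifs with hj
  · simpa [hj] using hone
  by_cases hj' : j ∈ ({-1, 1} : Finset ℤ)
  · exact hzero ⟨j, hj'⟩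
  have hj2 : 2 ≤ |j| := by
    simp only [Finset.mem_insert, Finset.mem_singleton] at hj'
    grind
  refine integral_eq_zero_of_ae (.of_forall fun x => ?_)
  by_cases hx : x ∈ tsupport θ
  · have hx1 : |x| < 1 := abs_lt.2 (hθU hx)
    have hj2' : (2 : ℝ) ≤ |(j : ℝ)| := by exact_mod_cast hj2
    have := abs_sub_abs_le_abs_sub (j : ℝ) x
    rw [abs_sub_comm] at this
    simp [hvanish (x - j) (by linarith)]
  · simp [image_eq_zero_of_notMem_tsupport hx]
end

section
/- Let φ ∈ C_c^∞(ℝ) satisfy supp φ ⊂ [-1,1] and φ(0) ≠ 0, and let d ≥ 1. Then the function Φ(x) = φ(x₁)⋯φ(x_d) on ℝ^d satisfies condition (A). -/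
open MeasureTheory Complex
open scoped ENNReal NNReal

open scoped ComplexConjugate

/-- The smooth complex functions on the line vanishing outside `(-1, 1)`. -/
def smoothUnitInterval : Submodule ℂ (ℝ → ℂ) where
  carrier := {θ | ContDiff ℝ (⊤ : ℕ∞) θ ∧ ∀ x ∉ Set.Ioo (-1 : ℝ) 1, θ x = 0}
  zero_mem' := ⟨contDiff_const, fun _ _ => rfl⟩
  add_mem' hf hg := ⟨hf.1.add hg.1, fun x hx => by simp [hf.2 x hx, hg.2 x hx]⟩
  smul_mem' c _ hf := ⟨hf.1.const_smul c, fun x hx => by simp [hf.2 x hx]⟩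

theorem smoothUnitInterval.hasCompactSupport (θ : smoothUnitInterval) :
    HasCompactSupport (θ : ℝ → ℂ) :=
  HasCompactSupport.intro isCompact_Icc
    fun x hx => θ.2.2 x fun h => hx (Set.Ioo_subset_Icc_self h)

theorem smoothUnitInterval.integrable_mul (θ : smoothUnitInterval) {u : ℝ → ℂ}
    (hu : Continuous u) : Integrable fun x => θ.1 x * u x :=
  (θ.2.1.continuous.mul hu).integrable_of_hasCompactSupport
    (smoothUnitInterval.hasCompactSupport θ).mul_right

/-- Integration of test functions against a continuous function. -/
noncomputable def pairing (u : ℝ → ℂ) (hu : Continuous u) : Module.Dual ℂ smoothUnitInterval where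
  toFun θ := ∫ x, θ.1 x * u x
  map_add' θ η := by
    rw [← integral_add (smoothUnitInterval.integrable_mul θ hu)
      (smoothUnitInterval.integrable_mul η hu)]
    exact integral_congr_ae (.of_forall fun x => add_mul _ _ _)
  map_smul' c θ := by
    simp only [RingHom.id_apply, smul_eq_mul]
    rw [← integral_const_mul]
    exact integral_congr_ae (.of_forall fun x => mul_assoc _ _ _)

/-- A smooth function that does not vanish at `0` is not annihilated by all test functions. -/
theorem exists_integral_mul_ne_zero {w : ℝ → ℂ} (hw : ContDiff ℝ (⊤ : ℕ∞) w) (h0 : w 0 ≠ 0) :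
    ∃ θ : smoothUnitInterval, ∫ x, θ.1 x * w x ≠ 0 := by
  let η : ContDiffBump (0 : ℝ) := ⟨1 / 4, 1 / 2, by norm_num, by norm_num⟩
  have hη : ContDiff ℝ (⊤ : ℕ∞) η := η.contDiff
  refine ⟨⟨fun x => (η x : ℂ) * conj (w x),
    (Complex.ofRealCLM.contDiff.comp hη).mul (Complex.conjCLE.contDiff.comp hw),
    fun x hx => ?_⟩, ?_⟩
  · have : η x = 0 := η.zero_of_le_dist <| by
      rw [Real.dist_0_eq_abs]
      by_contra! h
      have h' : |x| < 1 / 2 := h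
      rw [abs_lt] at h'
      exact hx ⟨by linarith, by linarith⟩
    simp [this]
  · have hpos : 0 < ∫ x, η x * ‖w x‖ ^ 2 := by
      refine Continuous.integral_pos_of_hasCompactSupport_nonneg_nonzero (x := 0)
        (hη.continuous.mul (hw.continuous.norm.pow 2)) η.hasCompactSupport.mul_right
        (fun x => mul_nonneg η.nonneg (sq_nonneg _)) ?_
      rw [η.one_of_mem_closedBall (by simp [η.rIn_pos.le])]
      simpa using h0
    have : ∫ x, ((η x : ℂ) * conj (w x)) * w x = ((∫ x, η x * ‖w x‖ ^ 2 : ℝ) : ℂ) := by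
      rw [← integral_complex_ofReal]
      refine integral_congr_ae (.of_forall fun x => ?_)
      simp [mul_assoc, Complex.conj_mul']
    simp only [this]
    exact_mod_cast hpos.ne'

theorem eq_zero_of_one_le_abs {φ : ℝ → ℂ} (hφ : Continuous φ)
    (hsupp : Function.support φ ⊆ Set.Icc (-1 : ℝ) 1) {x : ℝ} (hx : 1 ≤ |x|) : φ x = 0 := by
  by_contra h
  have hmem : Function.support φ ⊆ Set.Ioo (-1 : ℝ) 1 := by
    rw [← interior_Icc]
    exact (hφ.isOpen_support).subset_interior_iff.2 hsupp
  exact absurd (abs_lt.2 (hmem h)) (not_lt.2 hx)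

/-- A one-dimensional bump supported in `[-1,1]` that does not vanish at `0` satisfies
condition (A). -/
theorem conditionA1_of_support_subset_Icc {φ : ℝ → ℂ} (hsm : ContDiff ℝ (⊤ : ℕ∞) φ)
    (hsupp : Function.support φ ⊆ Set.Icc (-1 : ℝ) 1) (h0 : φ 0 ≠ 0) : ConditionA1 φ := by
  have hφ := hsm.continuous
  have hshift (j : ℤ) : ContDiff ℝ (⊤ : ℕ∞) fun x : ℝ => φ (x - j) :=
    hsm.comp (contDiff_id.sub contDiff_const)
  let F (j : ℤ) : Module.Dual ℂ smoothUnitInterval :=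
    pairing (fun x => φ (x - j)) (hshift j).continuous
  have hnot : F 0 ∉ Submodule.span ℂ (Set.range ![F 1, F (-1)]) := by
    intro hmem
    rw [Matrix.range_cons_cons_empty, Submodule.mem_span_pair] at hmem
    obtain ⟨a, b, hab⟩ := hmem
    obtain ⟨θ, hθ⟩ := exists_integral_mul_ne_zero
      (w := fun x => φ (x - (0 : ℤ)) - a * φ (x - (1 : ℤ)) - b * φ (x - (-1 : ℤ)))
      (((hshift 0).sub (contDiff_const.mul (hshift 1))).sub
        (contDiff_const.mul (hshift (-1)))) (by
        have h1 : φ (-1) = 0 := eq_zero_of_one_le_abs hφ hsupp (by simp)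
        have h2 : φ 1 = 0 := eq_zero_of_one_le_abs hφ hsupp (by simp)
        simpa [h1, h2] using h0)
    apply hθ
    have hint (j : ℤ) : Integrable fun x => θ.1 x * φ (x - j) :=
      smoothUnitInterval.integrable_mul θ (hshift j).continuous
    have hsub : Integrable fun x =>
        θ.1 x * φ (x - (0 : ℤ)) - a * (θ.1 x * φ (x - (1 : ℤ))) :=
      (hint 0).sub ((hint 1).const_mul a)
    have key : F 0 θ - a * F 1 θ - b * F (-1) θ = 0 := by
      rw [← hab]
      simp [smul_eq_mul]
    rw [← key]
    change _ = (∫ x, θ.1 x * φ (x - (0 : ℤ))) - a * (∫ x, θ.1 x * φ (x - (1 : ℤ))) -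
      b * (∫ x, θ.1 x * φ (x - (-1 : ℤ)))
    rw [← integral_const_mul, ← integral_const_mul,
      ← integral_sub (hint 0) ((hint 1).const_mul a),
      ← integral_sub hsub ((hint (-1)).const_mul b)]
    refine integral_congr_ae (.of_forall fun x => ?_)
    ring
  obtain ⟨θ, hθ, hθ0⟩ : ∃ θ, θ ∈ (⨅ i, LinearMap.ker (![F 1, F (-1)] i)) ∧ F 0 θ ≠ 0 := by
    by_contra! h
    exact hnot (mem_span_of_iInf_ker_le_ker fun θ hθ => h θ hθ)
  have h1 : F 1 θ = 0 := by simpa using (Submodule.mem_iInf _).1 hθ 0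
  have h2 : F (-1) θ = 0 := by simpa using (Submodule.mem_iInf _).1 hθ 1
  let ψ : smoothUnitInterval := (F 0 θ)⁻¹ • θ
  refine ⟨ψ, ψ.2.1, smoothUnitInterval.hasCompactSupport ψ, fun j => ?_⟩
  change F j ψ = _
  rw [map_smul, smul_eq_mul]
  by_cases hj : |j| ≤ 1
  · obtain rfl | rfl | rfl : j = -1 ∨ j = 0 ∨ j = 1 := by rw [abs_le] at hj; omega
    · simp [h2]
    · simp [hθ0]
    · simp [h1]
  · have hj2 : (2 : ℝ) ≤ |(j : ℝ)| := by
      rw [← Int.cast_abs]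
      exact_mod_cast not_le.1 hj
    have hj0 : j ≠ 0 := by rintro rfl; simp at hj
    have : F j θ = 0 := by
      change ∫ x, θ.1 x * φ (x - j) = 0
      refine integral_eq_zero_of_ae (.of_forall fun x => ?_)
      by_cases hx : x ∈ Set.Ioo (-1 : ℝ) 1
      · have := abs_lt.2 hx
        have h3 := abs_sub_abs_le_abs_sub (j : ℝ) x
        rw [abs_sub_comm] at h3
        simp [eq_zero_of_one_le_abs hφ hsupp (x := x - j) (by linarith)]
      · simp [θ.2.2 x hx]
    simp [this, hj0]

/-- Condition (A) passes from a function on the line to its tensor powers. -/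
theorem ConditionA1.prod {φ : ℝ → ℂ} (h : ConditionA1 φ) (d : ℕ) :
    ConditionA (fun x : Rn d => ∏ i, φ (x i)) := by
  obtain ⟨θ, hθ, hc, hint⟩ := h
  refine ⟨fun x => ∏ i, θ (x i), contDiff_prod fun i _ => hθ.comp (contDiff_apply ℝ ℝ i), ?_,
    fun α => ?_⟩
  · refine HasCompactSupport.intro (isCompact_univ_pi fun _ => hc.isCompact) fun x hx => ?_
    obtain ⟨i, hi⟩ : ∃ i, x i ∉ tsupport θ := by simpa [Set.mem_pi] using hx
    exact Finset.prod_eq_zero (Finset.mem_univ i) (image_eq_zero_of_notMem_tsupport hi)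
  · simp only [← Finset.prod_mul_distrib, Pi.sub_apply, coeZ]
    rw [integral_fintype_prod_volume_eq_prod (fun i x => θ x * φ (x - (α i : ℝ)))]
    simp only [hint, Finset.prod_ite_zero, Finset.prod_const_one, funext_iff, Finset.mem_univ,
      true_imp_iff, Pi.zero_apply]

/-- the tensor product `Φ(x) = φ(x₁)⋯φ(x_d)` of a one-dimensional bump
with `supp φ ⊂ [-1,1]` and `φ(0) ≠ 0` satisfies condition (A). -/
theorem statement12 (d : ℕ) (hd : 1 ≤ d) (φ : ℝ → ℂ) (hsm : ContDiff ℝ (⊤ : ℕ∞) φ)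
    (hc : HasCompactSupport φ) (hsupp : Function.support φ ⊆ Set.Icc (-1 : ℝ) 1)
    (h0 : φ 0 ≠ 0) :
    ConditionA (fun x : Rn d => ∏ i, φ (x i)) := by
  exact (conditionA1_of_support_subset_Icc hsm hsupp h0).prod d
end

section
/- Let φ ∈ C_c^∞(ℝ) satisfy supp φ ⊂ [-1,1] and φ(0) ≠ 0, and set φ̃(x) = φ(x) + φ(x−1). Then for every θ ∈ C_c^∞(ℝ) one has Σ_{k∈ℤ} (−1)^k ∫_ℝ θ(x) φ̃(x−k) dx = 0; consequently φ̃ does not satisfy condition (A). -/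
open MeasureTheory Complex
open scoped ENNReal NNReal

/-- The correlation of two compactly supported functions has finite support on `ℤ`. -/
theorem finite_support_integral_mul_comp_sub_intCast {θ φ : ℝ → ℂ}
    (hθ : HasCompactSupport θ) (hφ : HasCompactSupport φ) :
    (Function.support fun k : ℤ => ∫ x : ℝ, θ x * φ (x - (k : ℝ))).Finite := by
  obtain ⟨R, hR⟩ := hθ.isCompact.isBounded.exists_norm_le
  obtain ⟨S, hS⟩ := hφ.isCompact.isBounded.exists_norm_le
  refine (Set.finite_Icc (-⌈R + S⌉) ⌈R + S⌉).subset fun k hk => ?_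
  obtain ⟨x, hx⟩ : ∃ x : ℝ, θ x * φ (x - (k : ℝ)) ≠ 0 := by
    by_contra! h
    exact hk (by simp [h])
  have h1 := hR x (subset_tsupport _ (left_ne_zero_of_mul hx))
  have h2 := hS (x - k) (subset_tsupport _ (right_ne_zero_of_mul hx))
  rw [Real.norm_eq_abs, abs_le] at h1 h2
  have h3 := Int.le_ceil (R + S)
  constructor
  · rify
    linarith
  · rify
    linarith

/-- An alternating sum of consecutive sums telescopes to zero. -/
theorem tsum_neg_one_zpow_mul_add_succ_eq_zero {c : ℤ → ℂ} (hc : (Function.support c).Finite) :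
    ∑' k : ℤ, (-1 : ℂ) ^ k * (c k + c (k + 1)) = 0 := by
  set a : ℤ → ℂ := fun k => (-1 : ℂ) ^ k * c k with ha
  have hsum : Summable a :=
    summable_of_hasFiniteSupport (hc.subset (Function.support_mul_subset_right _ _))
  have hshift : Summable fun k : ℤ => a (k + 1) := (Equiv.addRight (1 : ℤ)).summable_iff.mpr hsum
  have hterm : ∀ k : ℤ, (-1 : ℂ) ^ k * (c k + c (k + 1)) = a k - a (k + 1) := by
    intro k
    simp only [ha, zpow_add_one₀ (show (-1 : ℂ) ≠ 0 by norm_num)]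
    ring
  rw [tsum_congr hterm, hsum.tsum_sub hshift, sub_eq_zero]
  exact ((Equiv.addRight (1 : ℤ)).tsum_eq a).symm

/-- for `φ̃(x) = φ(x) + φ(x−1)`, the alternating sums
`Σ_k (−1)^k ∫ θ(x) φ̃(x−k) dx` all vanish, so `φ̃` does not satisfy condition (A). -/
theorem statement14 (φ : ℝ → ℂ) (hsm : ContDiff ℝ (⊤ : ℕ∞) φ) (hc : HasCompactSupport φ)
    (hsupp : Function.support φ ⊆ Set.Icc (-1 : ℝ) 1) (h0 : φ 0 ≠ 0) :
    (∀ θ : ℝ → ℂ, ContDiff ℝ (⊤ : ℕ∞) θ → HasCompactSupport θ →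
      (∑' k : ℤ, (-1 : ℂ) ^ k *
        ∫ x : ℝ, θ x * (φ (x - (k : ℝ)) + φ (x - (k : ℝ) - 1))) = 0) ∧
    ¬ ConditionA1 (fun x : ℝ => φ x + φ (x - 1)) := by
  have key : ∀ θ : ℝ → ℂ, ContDiff ℝ (⊤ : ℕ∞) θ → HasCompactSupport θ →
      (∑' k : ℤ, (-1 : ℂ) ^ k *
        ∫ x : ℝ, θ x * (φ (x - (k : ℝ)) + φ (x - (k : ℝ) - 1))) = 0 := by
    intro θ hθ hθc
    have hint : ∀ k : ℤ, Integrable fun x : ℝ => θ x * φ (x - (k : ℝ)) := fun k =>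
      (hθ.continuous.mul
        (hsm.continuous.comp (continuous_sub_right _))).integrable_of_hasCompactSupport
        hθc.mul_right
    rw [← tsum_neg_one_zpow_mul_add_succ_eq_zero
      (finite_support_integral_mul_comp_sub_intCast hθc hc)]
    refine tsum_congr fun k => ?_
    rw [← integral_add (hint k) (hint (k + 1))]
    simp only [mul_add, Int.cast_add, Int.cast_one, sub_add_eq_sub_sub]
  refine ⟨key, ?_⟩
  rintro ⟨θ, hθ, hθc, hA⟩
  have h := key θ hθ hθc
  simp only [hA] at h
  simp at h
end

section
/- Let φ ∈ C_c^∞(ℝ) satisfy supp φ ⊂ [-1,1] and φ(0) ≠ 0, set φ̃(x) = φ(x) + φ(x−1), and for d ≥ 1 define Φ̃(x) = φ̃(x₁)⋯φ̃(x_d) on ℝ^d. Then Σ_{α∈ℤ^d} (−1)^{α₁+⋯+α_d} Φ̃(x−α) = 0 for all x ∈ ℝ^d, and consequently Φ̃ does not satisfy condition (A). -/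
open MeasureTheory Complex
open scoped ENNReal NNReal

/-- The alternating sum over `ℤ^d` of `g α + g (α + e_k)` telescopes to zero. -/
lemma tsum_neg_one_zpow_mul_add_shift_eq_zero {d : ℕ} (k : Fin d) {g : Zn d → ℂ}
    (hg : g.support.Finite) :
    ∑' α : Zn d, (-1 : ℂ) ^ (∑ i, α i) * (g α + g (α + Pi.single k 1)) = 0 := by
  set c : Zn d → ℂ := fun α => (-1 : ℂ) ^ (∑ i, α i) * g α with hc_def
  have hterm (α : Zn d) : (-1 : ℂ) ^ (∑ i, α i) * (g α + g (α + Pi.single k 1)) =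
      c α - c (Equiv.addRight (Pi.single k 1) α) := by
    simp only [hc_def, Equiv.coe_addRight, Pi.add_apply, Finset.sum_add_distrib,
      Finset.sum_pi_single', Finset.mem_univ, if_true,
      zpow_add₀ (neg_ne_zero.mpr (one_ne_zero (α := ℂ))), zpow_one]
    ring
  have hc : Summable c :=
    summable_of_hasFiniteSupport (hg.subset (Function.support_mul_subset_right _ _))
  have hshift : Summable fun α => c (Equiv.addRight (Pi.single k 1) α) :=
    (Equiv.summable_iff _).mpr hc
  rw [tsum_congr hterm, hc.tsum_sub hshift, Equiv.tsum_eq, sub_self]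

/-- A family indexed by `ℤ^d` is finitely supported as soon as its support is bounded. -/
lemma finite_support_of_coord_bound {d : ℕ} {g : Zn d → ℂ} {R : ℝ}
    (hg : ∀ α, g α ≠ 0 → ∀ i, |(α i : ℝ)| ≤ R) : g.support.Finite := by
  refine (Set.finite_Icc (fun _ => -⌈R⌉ : Zn d) (fun _ => ⌈R⌉)).subset fun α hα => ?_
  have h (i : Fin d) : |α i| ≤ ⌈R⌉ := by
    have := (hg α hα i).trans (Int.le_ceil R)
    exact_mod_cast this
  exact ⟨fun i => (abs_le.mp (h i)).1, fun i => (abs_le.mp (h i)).2⟩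

/-- The product of `φ(x_k)` with `φ(x_i) + φ(x_i - 1)` over the coordinates `i ≠ k`. -/
def mixedProd {d : ℕ} (k : Fin d) (φ : ℝ → ℂ) (x : Rn d) : ℂ :=
  φ (x k) * ∏ i ∈ Finset.univ.erase k, (φ (x i) + φ (x i - 1))

lemma continuous_mixedProd {d : ℕ} (k : Fin d) {φ : ℝ → ℂ} (hφ : Continuous φ) :
    Continuous (mixedProd k φ) := by
  unfold mixedProd
  fun_prop

lemma abs_le_two_of_mixedProd_ne_zero {d : ℕ} {k : Fin d} {φ : ℝ → ℂ}
    (hφ : Function.support φ ⊆ Set.Icc (-1 : ℝ) 1) {x : Rn d} (hx : mixedProd k φ x ≠ 0)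
    (i : Fin d) : |x i| ≤ 2 := by
  obtain ⟨hk, hprod⟩ := mul_ne_zero_iff.mp hx
  rw [abs_le]
  by_cases hik : i = k
  · have := hφ (hik ▸ hk : φ (x i) ≠ 0)
    constructor <;> linarith [this.1, this.2]
  · have hi := Finset.prod_ne_zero_iff.mp hprod i (by simp [hik])
    by_cases h : φ (x i) = 0
    · have := hφ (show φ (x i - 1) ≠ 0 by simpa [h] using hi)
      constructor <;> linarith [this.1, this.2]
    · have := hφ h
      constructor <;> linarith [this.1, this.2]

lemma prod_eq_mixedProd_add_shift {d : ℕ} (k : Fin d) (φ : ℝ → ℂ) (x : Rn d) (α : Zn d) :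
    ∏ i, (φ (x i - (α i : ℝ)) + φ (x i - (α i : ℝ) - 1)) =
      mixedProd k φ (x - coeZ α) + mixedProd k φ (x - coeZ (α + Pi.single k 1)) := by
  have hprod : ∏ i ∈ Finset.univ.erase k,
      (φ ((x - coeZ (α + Pi.single k 1) : Rn d) i) +
        φ ((x - coeZ (α + Pi.single k 1) : Rn d) i - 1)) =
      ∏ i ∈ Finset.univ.erase k, (φ (x i - (α i : ℝ)) + φ (x i - (α i : ℝ) - 1)) := by
    refine Finset.prod_congr rfl fun i hi => ?_
    simp [coeZ, Pi.single_eq_of_ne (Finset.ne_of_mem_erase hi)]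
  rw [← Finset.mul_prod_erase _ _ (Finset.mem_univ k), mixedProd, mixedProd, hprod]
  simp [coeZ, add_mul, sub_sub]

/-- A lattice translate of `mixedProd k φ` is nonzero in a ball only if the shift is bounded. -/
lemma abs_le_of_mixedProd_sub_ne_zero {d : ℕ} {k : Fin d} {φ : ℝ → ℂ}
    (hφ : Function.support φ ⊆ Set.Icc (-1 : ℝ) 1) {x : Rn d} {α : Zn d} {R : ℝ}
    (hx : ‖x‖ ≤ R) (h : mixedProd k φ (x - coeZ α) ≠ 0) (i : Fin d) :
    |(α i : ℝ)| ≤ R + 2 := by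
  have h₂ : |x i - (α i : ℝ)| ≤ 2 := abs_le_two_of_mixedProd_ne_zero hφ h i
  have h₁ : |x i| ≤ R := (norm_le_pi_norm x i).trans hx
  rw [abs_le] at *
  constructor <;> linarith

/-- for `φ̃(x) = φ(x) + φ(x−1)` and `Φ̃(x) = φ̃(x₁)⋯φ̃(x_d)`, the
alternating lattice sums of translates of `Φ̃` vanish identically, so `Φ̃` does not
satisfy condition (A). -/
theorem statement15 (d : ℕ) (hd : 1 ≤ d) (φ : ℝ → ℂ) (hsm : ContDiff ℝ (⊤ : ℕ∞) φ)
    (hc : HasCompactSupport φ) (hsupp : Function.support φ ⊆ Set.Icc (-1 : ℝ) 1)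
    (h0 : φ 0 ≠ 0) :
    (∀ x : Rn d, (∑' α : Zn d, (-1 : ℂ) ^ (∑ i, α i) *
        ∏ i, (φ (x i - (α i : ℝ)) + φ (x i - (α i : ℝ) - 1))) = 0) ∧
    ¬ ConditionA (fun x : Rn d => ∏ i, (φ (x i) + φ (x i - 1))) := by
  let k : Fin d := ⟨0, hd⟩
  constructor
  · intro x
    simp_rw [prod_eq_mixedProd_add_shift k φ x]
    exact tsum_neg_one_zpow_mul_add_shift_eq_zero k
      (g := fun α => mixedProd k φ (x - coeZ α))
      (finite_support_of_coord_bound fun _ h => abs_le_of_mixedProd_sub_ne_zero hsupp le_rfl h)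
  · rintro ⟨Θ, hΘ, hΘc, hint⟩
    let g : Zn d → ℂ := fun α => ∫ x : Rn d, Θ x * mixedProd k φ (x - coeZ α)
    obtain ⟨R, hR⟩ := hΘc.isCompact.isBounded.exists_norm_le
    have hg : g.support.Finite := by
      refine finite_support_of_coord_bound (R := R + 2) fun α hα i => ?_
      obtain ⟨x, hx⟩ : ∃ x : Rn d, Θ x * mixedProd k φ (x - coeZ α) ≠ 0 := by
        by_contra! h
        exact hα (by simp [g, h])
      obtain ⟨hΘx, hψ⟩ := mul_ne_zero_iff.mp hx
      exact abs_le_of_mixedProd_sub_ne_zero hsupp (hR x (subset_tsupport _ hΘx)) hψ i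
    have hintegrable (α : Zn d) :
        Integrable fun x : Rn d => Θ x * mixedProd k φ (x - coeZ α) :=
      (hΘ.continuous.mul ((continuous_mixedProd k hsm.continuous).comp
        (continuous_id.sub continuous_const))).integrable_of_hasCompactSupport hΘc.mul_right
    have hsplit (α : Zn d) : g α + g (α + Pi.single k 1) = if α = 0 then 1 else 0 := by
      rw [← hint α, ← integral_add (hintegrable _) (hintegrable _)]
      refine integral_congr_ae (.of_forall fun x => ?_)
      dsimp only
      rw [← mul_add, ← prod_eq_mixedProd_add_shift]
      rfl
    have hzero := tsum_neg_one_zpow_mul_add_shift_eq_zero k hg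
    simp [hsplit] at hzero
end
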